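/- Let m be a positive multiple of 6 and set r := ⌊(m−1)/6⌋ = m/6 − 1. Let (R_n)_{n≥0} be a cyclic urn process with m types started with one ball of type 0, and suppose Ξ_1, …, Ξ_r are complex-valued random variables on the same probability space such that M_{k,n} → Ξ_k almost surely as n → ∞ for each 1 ≤ k ≤ r. For n ≥ 2 define the ℝ²-valued vectors X_{n,k} := n^{−1/2}·(Re(u_k(R_n − E[R_n]) − n^{ω^k} Ξ_k), Im(u_k(R_n − E[R_n]) − n^{ω^k} Ξ_k)) for 1 ≤ k ≤ r; X_{n,m/6} := (n log n)^{−1/2}·(Re(u_{m/6}(R_n − E[R_n])), Im(u_{m/6}(R_n − E[R_n]))); X_{n,k} := n^{−1/2}·(Re(u_k(R_n − E[R_n])), Im(u_k(R_n − E[R_n]))) for r+2 ≤ k ≤ m/2 − 1; and the real random variable X_{n,m/2} := n^{−1/2} u_{m/2}(R_n). Let Z_n := (X_{n,1}, …, X_{n,m/2−1}, X_{n,m/2}) ∈ ℝ^{m−1}. Then, as n → ∞, Z_n converges in distribution to 𝒩(0, M_m), where M_m := (1/2)·diag(Id₂/|2λ_1−1|, …, Id₂/|2λ_r−1|, Id₂,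 Id₂/|2λ_{r+2}−1|, …, Id₂/|2λ_{m/2−1}−1|, 2/3) is the (m−1)×(m−1) block-diagonal matrix with 2×2 blocks indexed by k = 1, …, m/2−1 (the block for k = m/6 being (1/2)Id₂) and final 1×1 entry 1/3. -/

import Mathlib

open MeasureTheory ProbabilityTheory Filter Complex Finset Topology

noncomputable section

/-- `ω = exp(2πi/m)`, the `m`-th elementary root of unity. -/
def cw (m : ℕ) : ℂ := Complex.exp (2 * Real.pi * Complex.I / m)

/-- `λ_k = cos(2πk/m)`. -/
def lam (m k : ℕ) : ℝ := Real.cos (2 * Real.pi * k / m)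

/-- `μ_k = sin(2πk/m)`. -/
def muim (m k : ℕ) : ℝ := Real.sin (2 * Real.pi * k / m)

/-- the eigenvector `v_k = (1/m)(1, ω^{-k}, …, ω^{-(m-1)k})`. -/
def vvec (m k : ℕ) : Fin m → ℂ :=
  fun t => (m : ℂ)⁻¹ * cw m ^ (-((k * (t : ℕ) : ℕ) : ℤ))

/-- the dual coefficient `u_k(w) = ∑_t ω^{kt} w_t`. -/
def ucoef (m k : ℕ) (w : Fin m → ℝ) : ℂ :=
  ∑ t : Fin m, cw m ^ (k * (t : ℕ)) * (w t : ℂ)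

/-- the replacement matrix `A` of the cyclic urn. -/
def repA (m : ℕ) : Matrix (Fin m) (Fin m) ℝ :=
  Matrix.of fun i j => if (j : ℕ) = ((i : ℕ) + 1) % m then 1 else 0

/-- the filtration `𝓕_n = σ(R_0, …, R_n)`. -/
def urnFilt {Ω : Type*} [MeasurableSpace Ω] (m : ℕ) (R : ℕ → Ω → Fin m → ℝ) (n : ℕ) :
    MeasurableSpace Ω :=
  ⨆ i ∈ Finset.range (n + 1), MeasurableSpace.comap (R i) inferInstance

/-- A cyclic urn process with `m` types started with one ball of type `j0`. -/
structure IsCyclicUrn {Ω : Type*} [MeasurableSpace Ω] (μ : Measure Ω) (m : ℕ) (j0 : Fin m)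
    (R : ℕ → Ω → Fin m → ℝ) : Prop where
  isProb : IsProbabilityMeasure μ
  meas : ∀ n, Measurable (R n)
  natVal : ∀ n ω i, ∃ z : ℕ, R n ω i = z
  init : ∀ ω, R 0 ω = fun i => if i = j0 then 1 else 0
  step : ∀ n, ∀ j : Fin m,
    μ[Set.indicator {ω | R (n + 1) ω =
        fun i => R n ω i + if (i : ℕ) = ((j : ℕ) + 1) % m then 1 else 0}
      (fun _ => (1 : ℝ)) | urnFilt m R n]
      =ᵐ[μ] fun ω => R n ω j / (n + 1)

/-- componentwise expectation `E[X]` of a random vector. -/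
def expVec {Ω : Type*} [MeasurableSpace Ω] (μ : Measure Ω) {m : ℕ}
    (X : Ω → Fin m → ℝ) : Fin m → ℝ := fun i => ∫ ω, X ω i ∂μ

/-- the martingale `M_{k,n} = (Γ(n+1)/Γ(n+1+ω^k)) u_k(R_n - E[R_n])`, with `M_{k,0} = 0`. -/
def Mart {Ω : Type*} [MeasurableSpace Ω] (μ : Measure Ω) (m k : ℕ)
    (R : ℕ → Ω → Fin m → ℝ) (n : ℕ) (ω : Ω) : ℂ :=
  if n = 0 then 0
  else (Complex.Gamma ((n : ℂ) + 1) / Complex.Gamma ((n : ℂ) + 1 + cw m ^ k)) *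
    ucoef m k (fun t => R n ω t - expVec μ (R n) t)

/-- `ν` is the centered Gaussian distribution `𝒩(0, S)` on `ℝ^d` (Cramér–Wold
characterization: every linear functional is one-dimensional centered Gaussian). -/
def IsCenteredGaussian {d : ℕ} (ν : Measure (Fin d → ℝ)) (S : Matrix (Fin d) (Fin d) ℝ) : Prop :=
  IsProbabilityMeasure ν ∧
  ∀ l : Fin d → ℝ,
    ν.map (fun x => ∑ i, l i * x i) =
      gaussianReal 0 (Real.toNNReal (∑ i, ∑ j, l i * S i j * l j))

/-- convergence in distribution of the random vectors `X_n` to the law `ν`. -/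
def TendstoInDist {Ω : Type*} [MeasurableSpace Ω] (μ : Measure Ω) {d : ℕ}
    (X : ℕ → Ω → Fin d → ℝ) (ν : Measure (Fin d → ℝ)) : Prop :=
  ∀ f : BoundedContinuousFunction (Fin d → ℝ) ℝ,
    Tendsto (fun n => ∫ ω, f (X n ω) ∂μ) atTop (𝓝 (∫ x, f x ∂ν))


/-- the components of the vector `Z_n = (X_{n,1}, …, X_{n,m/2}) ∈ ℝ^{m-1}`:
coordinates `2k-2, 2k-1` (0-indexed) carry real and imaginary part of the
(possibly residual-)normalized `k`-th projection, `1 ≤ k ≤ m/2 - 1`, and the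
last coordinate carries `X_{n,m/2} = n^{-1/2} u_{m/2}(R_n)`. -/
def Zvec {Ω : Type*} [MeasurableSpace Ω] (μ : Measure Ω) (m : ℕ)
    (R : ℕ → Ω → Fin m → ℝ) (Ξ : ℕ → Ω → ℂ) (n : ℕ) (ω : Ω) (i : Fin (m - 1)) : ℝ :=
  if (i : ℕ) = m - 2 then
    (Real.sqrt n)⁻¹ * (ucoef m (m / 2) (R n ω)).re
  else
    let k := (i : ℕ) / 2 + 1
    let c : ℂ :=
      if k < m / 6 then
        ((Real.sqrt n : ℝ) : ℂ)⁻¹ *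
          (ucoef m k (fun t => R n ω t - expVec μ (R n) t) - (n : ℂ) ^ (cw m ^ k) * Ξ k ω)
      else if k = m / 6 then
        ((Real.sqrt (n * Real.log n) : ℝ) : ℂ)⁻¹ *
          ucoef m k (fun t => R n ω t - expVec μ (R n) t)
      else
        ((Real.sqrt n : ℝ) : ℂ)⁻¹ * ucoef m k (fun t => R n ω t - expVec μ (R n) t)
    if (i : ℕ) % 2 = 0 then c.re else c.im

/-- the diagonal of the limit covariance matrix `M_m`. -/
def MmDiag (m : ℕ) : Fin (m - 1) → ℝ := fun i =>
  if (i : ℕ) = m - 2 then 1 / 3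
  else if (i : ℕ) / 2 + 1 = m / 6 then 1 / 2
  else (1 / 2) * |2 * lam m ((i : ℕ) / 2 + 1) - 1|⁻¹

/-- the limit covariance matrix `M_m`. -/
def MmMat (m : ℕ) : Matrix (Fin (m - 1)) (Fin (m - 1)) ℝ := Matrix.diagonal (MmDiag m)

lemma integral_exp_sum_pi_gaussianReal {d : ℕ} (v : Fin d → ℝ) (hv : ∀ i, 0 ≤ v i)
    (l : Fin d → ℝ) :
    ∫ x, Complex.exp (((∑ i, l i * x i : ℝ) : ℂ) * I)
      ∂(Measure.pi fun i => gaussianReal 0 (v i).toNNReal) =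
      Complex.exp (-((∑ i, l i ^ 2 * v i : ℝ) : ℂ) / 2) := by
  have h1 : ∀ x : Fin d → ℝ, Complex.exp (((∑ i, l i * x i : ℝ) : ℂ) * I) =
      ∏ i, Complex.exp (((l i * x i : ℝ) : ℂ) * I) := by
    intro x
    rw [← Complex.exp_sum, Complex.ofReal_sum, Finset.sum_mul]
  simp_rw [h1]
  rw [integral_fintype_prod_eq_prod
    (f := fun i (y : ℝ) => Complex.exp (((l i * y : ℝ) : ℂ) * I))]
  have h2 : ∀ i, ∫ y, Complex.exp (((l i * y : ℝ) : ℂ) * I) ∂(gaussianReal 0 (v i).toNNReal) =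
      Complex.exp (-((l i ^ 2 * v i : ℝ) : ℂ) / 2) := by
    intro i
    have := charFun_gaussianReal (μ := 0) (v := (v i).toNNReal) (l i)
    rw [charFun_apply_real] at this
    push_cast
    rw [this]
    congr 1
    rw [show (((v i).toNNReal : ℝ) : ℂ) = (v i : ℂ) by rw [Real.coe_toNNReal _ (hv i)]]
    push_cast
    ring
  simp_rw [h2]
  rw [← Complex.exp_sum]
  congr 1
  push_cast
  rw [← Finset.sum_div, ← Finset.sum_neg_distrib]

lemma isCenteredGaussian_pi {d : ℕ} (v : Fin d → ℝ) (hv : ∀ i, 0 ≤ v i) :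
    IsCenteredGaussian (Measure.pi fun i => gaussianReal 0 (v i).toNNReal)
      (Matrix.diagonal v) := by
  refine ⟨inferInstance, fun l => ?_⟩
  have hm : Measurable fun x : Fin d → ℝ => ∑ i, l i * x i := by fun_prop
  have := Measure.isProbabilityMeasure_map (μ := Measure.pi fun i => gaussianReal 0 (v i).toNNReal)
    hm.aemeasurable
  refine Measure.ext_of_charFun (funext fun t => ?_)
  have hS : ∑ i, ∑ j, l i * Matrix.diagonal v i j * l j = ∑ i, l i ^ 2 * v i := by
    refine Finset.sum_congr rfl fun i _ => ?_
    rw [Finset.sum_eq_single i]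
    · simp; ring
    · intro j _ hj; simp [Matrix.diagonal_apply_ne _ hj.symm]
    · simp
  rw [charFun_gaussianReal, hS, charFun_apply_real, integral_map hm.aemeasurable (by fun_prop)]
  have h := integral_exp_sum_pi_gaussianReal v hv (fun i => t * l i)
  have h0 : 0 ≤ ∑ i, l i ^ 2 * v i := Finset.sum_nonneg fun i _ => mul_nonneg (sq_nonneg _) (hv i)
  rw [Real.coe_toNNReal _ h0]
  have e1 : ∀ x : Fin d → ℝ, (t : ℂ) * ((∑ i, l i * x i : ℝ) : ℂ) * I =
      ((∑ i, t * l i * x i : ℝ) : ℂ) * I := by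
    intro x
    rw [← Complex.ofReal_mul, Finset.mul_sum]
    simp_rw [mul_assoc]
  simp_rw [e1, h]
  congr 1
  have : ∑ i, (t * l i) ^ 2 * v i = t ^ 2 * ∑ i, l i ^ 2 * v i := by
    rw [Finset.mul_sum]; exact Finset.sum_congr rfl fun i _ => by ring
  rw [this]
  push_cast
  ring

lemma tendstoInDist_of_tendsto_integral_exp {Ω : Type*} [MeasurableSpace Ω] {μ : Measure Ω}
    [IsProbabilityMeasure μ] {d : ℕ} {X : ℕ → Ω → Fin d → ℝ} (hX : ∀ n, AEMeasurable (X n) μ)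
    {ν : Measure (Fin d → ℝ)} [IsProbabilityMeasure ν]
    (h : ∀ l : Fin d → ℝ,
      Tendsto (fun n => ∫ ω, Complex.exp (((∑ i, l i * X n ω i : ℝ) : ℂ) * I) ∂μ) atTop
        (𝓝 (∫ x, Complex.exp (((∑ i, l i * x i : ℝ) : ℂ) * I) ∂ν))) :
    TendstoInDist μ X ν := by
  intro f
  let e := MeasurableEquiv.toLp 2 (Fin d → ℝ)
  have hem : Measurable e := e.measurable
  have hec : Continuous (WithLp.ofLp : EuclideanSpace ℝ (Fin d) → Fin d → ℝ) :=
    PiLp.continuous_ofLp 2 _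
  have hXe : ∀ n, AEMeasurable (fun ω => e (X n ω)) μ := fun n => hem.comp_aemeasurable (hX n)
  let P : ℕ → ProbabilityMeasure (EuclideanSpace ℝ (Fin d)) := fun n =>
    ⟨μ.map (fun ω => e (X n ω)), Measure.isProbabilityMeasure_map (hXe n)⟩
  let Q : ProbabilityMeasure (EuclideanSpace ℝ (Fin d)) :=
    ⟨ν.map e, Measure.isProbabilityMeasure_map hem.aemeasurable⟩
  have hin : ∀ (x : Fin d → ℝ) (t : EuclideanSpace ℝ (Fin d)),
      (inner ℝ (e x) t : ℝ) = ∑ i, t i * x i := by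
    intro x t
    rw [PiLp.inner_apply]
    exact Finset.sum_congr rfl fun i _ => by simp [e]
  have hPQ : Tendsto P atTop (𝓝 Q) := by
    rw [ProbabilityMeasure.tendsto_iff_tendsto_charFun]
    intro t
    have e1 : ∀ n, charFun (P n : Measure (EuclideanSpace ℝ (Fin d))) t =
        ∫ ω, Complex.exp (((∑ i, t i * X n ω i : ℝ) : ℂ) * I) ∂μ := by
      intro n
      change charFun (μ.map (fun ω => e (X n ω))) t = _
      rw [charFun_apply, integral_map (hXe n) (by fun_prop)]
      simp_rw [hin]
    have e2 : charFun (Q : Measure (EuclideanSpace ℝ (Fin d))) t =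
        ∫ x, Complex.exp (((∑ i, t i * x i : ℝ) : ℂ) * I) ∂ν := by
      change charFun (ν.map e) t = _
      rw [charFun_apply, integral_map hem.aemeasurable (by fun_prop)]
      simp_rw [hin]
    simp_rw [e1, e2]
    exact h fun i => t i
  rw [ProbabilityMeasure.tendsto_iff_forall_integral_tendsto] at hPQ
  have := hPQ (f.compContinuous ⟨_, hec⟩)
  have e1 : ∀ n, ∫ x, (f.compContinuous ⟨_, hec⟩) x
      ∂(P n : Measure (EuclideanSpace ℝ (Fin d))) = ∫ ω, f (X n ω) ∂μ := by
    intro n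
    change ∫ x, (f.compContinuous ⟨_, hec⟩) x ∂(μ.map (fun ω => e (X n ω))) = _
    rw [integral_map (hXe n) (by exact (BoundedContinuousFunction.continuous _).aestronglyMeasurable)]
    rfl
  have e2 : ∫ x, (f.compContinuous ⟨_, hec⟩) x
      ∂(Q : Measure (EuclideanSpace ℝ (Fin d))) = ∫ x, f x ∂ν := by
    change ∫ x, (f.compContinuous ⟨_, hec⟩) x ∂(ν.map e) = _
    rw [integral_map hem.aemeasurable
      (by exact (BoundedContinuousFunction.continuous _).aestronglyMeasurable)]
    rfl
  simp_rw [e1, e2] at this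
  exact this

/-- The urn `w` after adding a ball of the type following `j`. -/
def addBall {m : ℕ} (w : Fin m → ℝ) (j : Fin m) : Fin m → ℝ :=
  fun i => w i + if (i : ℕ) = ((j : ℕ) + 1) % m then 1 else 0

lemma measurable_addBall {m : ℕ} (j : Fin m) : Measurable fun w : Fin m → ℝ => addBall w j := by
  unfold addBall
  fun_prop

lemma addBall_injective {m : ℕ} (w : Fin m → ℝ) : Function.Injective (addBall w) := by
  intro j j' h
  have hm : 0 < m := j.pos
  have h1 := congrFun h ⟨((j : ℕ) + 1) % m, Nat.mod_lt _ hm⟩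
  simp only [addBall, if_true] at h1
  have h2 : ((j : ℕ) + 1) % m = ((j' : ℕ) + 1) % m := by
    by_contra hne
    rw [if_neg hne] at h1
    linarith
  have h3 : (j : ℕ) ≡ j' [MOD m] := Nat.ModEq.add_right_cancel' 1 h2
  exact Fin.ext (Nat.ModEq.eq_of_lt_of_lt h3 j.2 j'.2)

lemma sum_addBall {m : ℕ} (w : Fin m → ℝ) (j : Fin m) : ∑ i, addBall w j i = ∑ i, w i + 1 := by
  have hm : 0 < m := j.pos
  simp only [addBall, Finset.sum_add_distrib]
  congr 1
  rw [Finset.sum_eq_single ⟨((j : ℕ) + 1) % m, Nat.mod_lt _ hm⟩]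
  · simp
  · intro b _ hb
    rw [if_neg]
    intro h
    exact hb (Fin.ext h)
  · simp

section Urn

variable {Ω : Type*} [mΩ : MeasurableSpace Ω] {μ : Measure Ω} {m : ℕ} {j0 : Fin m}
  {R : ℕ → Ω → Fin m → ℝ}

namespace IsCyclicUrn

lemma filt_le (hR : IsCyclicUrn μ m j0 R) (n : ℕ) : urnFilt m R n ≤ mΩ := by
  refine iSup₂_le fun i _ => ?_
  exact (hR.meas i).comap_le

lemma measurable_filt {n i : ℕ} (h : i ≤ n) : Measurable[urnFilt m R n] (R i) := by
  have h1 : MeasurableSpace.comap (R i) inferInstance ≤ urnFilt m R n :=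
    le_iSup₂_of_le (f := fun i (_ : i ∈ Finset.range (n + 1)) =>
      MeasurableSpace.comap (R i) inferInstance) i (Finset.mem_range.2 (by omega)) le_rfl
  exact Measurable.mono (comap_measurable (R i)) h1 le_rfl

lemma measurableSet_step (hR : IsCyclicUrn μ m j0 R) (n : ℕ) (j : Fin m) :
    MeasurableSet {ω | R (n + 1) ω = addBall (R n ω) j} :=
  measurableSet_eq_fun (hR.meas _) ((measurable_addBall j).comp (hR.meas n))

lemma nonneg (hR : IsCyclicUrn μ m j0 R) (n : ℕ) (ω : Ω) (i : Fin m) : 0 ≤ R n ω i := by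
  obtain ⟨z, hz⟩ := hR.natVal n ω i
  rw [hz]; positivity

/-- Integrating an `𝓕_n`-measurable function over the event that a ball of type `j` is drawn. -/
lemma integral_indicator_step (hR : IsCyclicUrn μ m j0 R) (n : ℕ) (j : Fin m) {h : Ω → ℂ}
    (hm : StronglyMeasurable[urnFilt m R n] h) (hi : Integrable h μ) :
    ∫ ω, {ω | R (n + 1) ω = addBall (R n ω) j}.indicator h ω ∂μ =
      ∫ ω, ((R n ω j / (n + 1) : ℝ) : ℂ) * h ω ∂μ := by
  have := hR.isProb
  set A := {ω | R (n + 1) ω = addBall (R n ω) j} with hA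
  have hAm : MeasurableSet A := hR.measurableSet_step n j
  have hs : μ[A.indicator (fun _ => (1 : ℝ)) | urnFilt m R n] =ᵐ[μ]
      fun ω => R n ω j / (n + 1) := hR.step n j
  have h1 : A.indicator h = fun ω => A.indicator (fun _ => (1 : ℝ)) ω • h ω := by
    ext ω
    by_cases hω : ω ∈ A <;> simp [hω]
  have hInt : Integrable (fun ω => A.indicator (fun _ => (1 : ℝ)) ω • h ω) μ := by
    rw [← h1]; exact hi.indicator hAm
  have hone : Integrable (A.indicator (fun _ => (1 : ℝ))) μ := (integrable_const 1).indicator hAm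
  have h2 := condExp_bilin_of_stronglyMeasurable_right (m := urnFilt m R n) (μ := μ)
    (ContinuousLinearMap.lsmul ℝ ℝ : ℝ →L[ℝ] ℂ →L[ℝ] ℂ) hm
    (f := A.indicator (fun _ => (1 : ℝ))) hInt hone
  rw [h1, ← integral_condExp (hR.filt_le n)]
  refine integral_congr_ae ?_
  filter_upwards [h2, hs] with ω h2 hs
  refine h2.trans ?_
  simp only [ContinuousLinearMap.lsmul_apply]
  rw [hs]
  simp

lemma integrable_coord_of_ae_sum (hR : IsCyclicUrn μ m j0 R) {n : ℕ}
    (hs : ∀ᵐ ω ∂μ, ∑ i, R n ω i = n + 1) (j : Fin m) : Integrable (fun ω => R n ω j) μ := by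
  have := hR.isProb
  refine Integrable.of_bound ((measurable_pi_apply j).comp (hR.meas n)).aestronglyMeasurable
    (n + 1 : ℝ) ?_
  filter_upwards [hs] with ω hω
  rw [← hω, Real.norm_of_nonneg (hR.nonneg n ω j)]
  exact Finset.single_le_sum (f := fun i => R n ω i) (fun i _ => hR.nonneg n ω i)
    (Finset.mem_univ j)

lemma ae_exists_step_of_ae_sum (hR : IsCyclicUrn μ m j0 R) {n : ℕ}
    (hs : ∀ᵐ ω ∂μ, ∑ i, R n ω i = n + 1) :
    ∀ᵐ ω ∂μ, ∃ j, R (n + 1) ω = addBall (R n ω) j := by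
  have := hR.isProb
  set A : Fin m → Set Ω := fun j => {ω | R (n + 1) ω = addBall (R n ω) j} with hA
  have hAm : ∀ j, MeasurableSet (A j) := hR.measurableSet_step n
  have hreal : ∀ j, μ.real (A j) = ∫ ω, R n ω j / (n + 1) ∂μ := by
    intro j
    have h := hR.integral_indicator_step n j (h := fun _ => 1)
      (stronglyMeasurable_const) (integrable_const _)
    have h' : ((μ.real (A j) : ℝ) : ℂ) = ((∫ ω, R n ω j / (n + 1) ∂μ : ℝ) : ℂ) := by
      rw [← integral_complex_ofReal]
      simp only [mul_one] at h
      rw [← h, integral_indicator (hAm j)]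
      simp [A]
    exact_mod_cast h'
  have hdisj : Pairwise (fun i j => Disjoint (A i) (A j)) := by
    intro i j hij
    rw [Set.disjoint_left]
    intro ω hi hj
    exact hij (addBall_injective _ (hi.symm.trans hj))
  have hU : μ.real (⋃ j, A j) = 1 := by
    rw [measureReal_iUnion_fintype hdisj hAm]
    simp_rw [hreal]
    rw [← integral_finsetSum _ fun j _ => (hR.integrable_coord_of_ae_sum hs j).div_const _]
    have : (fun ω => ∑ j, R n ω j / ((n : ℝ) + 1)) =ᵐ[μ] fun _ => (1 : ℝ) := by
      filter_upwards [hs] with ω hω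
      rw [← Finset.sum_div, hω, div_self (by positivity)]
    rw [integral_congr_ae this]
    simp
  have hU' : μ (⋃ j, A j) = 1 := by
    rw [measureReal_def] at hU
    rw [← ENNReal.ofReal_toReal (measure_ne_top μ _), hU, ENNReal.ofReal_one]
  have := (mem_ae_iff_prob_eq_one (MeasurableSet.iUnion hAm)).2 hU'
  filter_upwards [this] with ω hω
  exact Set.mem_iUnion.1 hω

lemma ae_sum_eq (hR : IsCyclicUrn μ m j0 R) (n : ℕ) : ∀ᵐ ω ∂μ, ∑ i, R n ω i = n + 1 := by
  induction n with
  | zero => exact ae_of_all _ fun ω => by simp [hR.init ω]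
  | succ n ih =>
    filter_upwards [ih, hR.ae_exists_step_of_ae_sum ih] with ω h ⟨j, hj⟩
    rw [hj, sum_addBall, h]
    push_cast
    ring

lemma ae_exists_step (hR : IsCyclicUrn μ m j0 R) (n : ℕ) :
    ∀ᵐ ω ∂μ, ∃ j, R (n + 1) ω = addBall (R n ω) j :=
  hR.ae_exists_step_of_ae_sum (hR.ae_sum_eq n)

lemma integrable_coord_mul (hR : IsCyclicUrn μ m j0 R) (n : ℕ) (j : Fin m) {h : Ω → ℂ}
    (hi : Integrable h μ) : Integrable (fun ω => ((R n ω j / (n + 1) : ℝ) : ℂ) * h ω) μ := by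
  refine hi.bdd_mul (c := 1) ?_ ?_
  · exact (Complex.measurable_ofReal.comp
      (((measurable_pi_apply j).comp (hR.meas n)).div_const _)).aestronglyMeasurable
  · filter_upwards [hR.ae_sum_eq n] with ω hω
    rw [Complex.norm_real, Real.norm_of_nonneg (div_nonneg (hR.nonneg n ω j) (by positivity)),
      div_le_one (by positivity), ← hω]
    exact Finset.single_le_sum (f := fun i => R n ω i) (fun i _ => hR.nonneg n ω i)
      (Finset.mem_univ j)

/-- One-step transition identity of the urn: if `X` agrees with the `𝓕_n`-measurable `h j` when a
ball of type `j` is drawn, then `E[X] = E[∑ j, R_{n,j}/(n+1) h j]`. -/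
lemma integral_step (hR : IsCyclicUrn μ m j0 R) (n : ℕ) {X : Ω → ℂ} {h : Fin m → Ω → ℂ}
    (hm : ∀ j, StronglyMeasurable[urnFilt m R n] (h j)) (hi : ∀ j, Integrable (h j) μ)
    (hX : ∀ᵐ ω ∂μ, ∀ j, R (n + 1) ω = addBall (R n ω) j → X ω = h j ω) :
    ∫ ω, X ω ∂μ = ∫ ω, ∑ j, ((R n ω j / (n + 1) : ℝ) : ℂ) * h j ω ∂μ := by
  have h1 : X =ᵐ[μ] fun ω => ∑ j, {ω | R (n + 1) ω = addBall (R n ω) j}.indicator (h j) ω := by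
    filter_upwards [hX, hR.ae_exists_step n] with ω hω ⟨j, hj⟩
    rw [Finset.sum_eq_single j]
    · rw [Set.indicator_of_mem (by exact hj), hω j hj]
    · intro i _ hij
      rw [Set.indicator_of_notMem]
      intro hi
      exact hij (addBall_injective _ (Eq.trans (Eq.symm hi) hj))
    · simp
  rw [integral_congr_ae h1, integral_finsetSum _ fun j _ =>
    (hi j).indicator (hR.measurableSet_step n j),
    integral_finsetSum _ fun j _ => hR.integrable_coord_mul n j (hi j)]
  exact Finset.sum_congr rfl fun j _ => hR.integral_indicator_step n j (hm j) (hi j)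

end IsCyclicUrn
end Urn

lemma cw_pow_eq (m q : ℕ) : cw m ^ q = Complex.exp (((2 * Real.pi * q / m : ℝ) : ℂ) * I) := by
  rw [cw, ← Complex.exp_nat_mul]
  congr 1
  push_cast
  ring

lemma norm_cw_pow (m q : ℕ) : ‖cw m ^ q‖ = 1 := by
  rw [cw_pow_eq, Complex.norm_exp_ofReal_mul_I]

lemma cw_pow_re (m q : ℕ) : (cw m ^ q).re = lam m q := by
  rw [cw_pow_eq, Complex.exp_ofReal_mul_I_re, lam]

lemma cw_pow_self {m : ℕ} (hm : 0 < m) : cw m ^ m = 1 :=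
  (Complex.isPrimitiveRoot_exp m hm.ne').pow_eq_one

lemma cw_pow_mod {m : ℕ} (hm : 0 < m) (q t : ℕ) : cw m ^ (q * (t % m)) = cw m ^ (q * t) := by
  conv_rhs => rw [← Nat.mod_add_div t m]
  rw [mul_add, pow_add, mul_left_comm, pow_mul (cw m) m, cw_pow_self hm, one_pow, mul_one]

lemma conj_cw_pow {m : ℕ} (hm : 0 < m) {l : ℕ} (hl : l ≤ m) (t : ℕ) :
    (starRingEnd ℂ) (cw m ^ (l * t)) = cw m ^ ((m - l) * t) := by
  have h1 : cw m ^ (l * t) * cw m ^ ((m - l) * t) = 1 := by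
    rw [← pow_add, ← add_mul, Nat.add_sub_cancel' hl, pow_mul, cw_pow_self hm, one_pow]
  have h2 : cw m ^ (l * t) * (starRingEnd ℂ) (cw m ^ (l * t)) = 1 := by
    rw [Complex.mul_conj, Complex.normSq_eq_norm_sq, norm_cw_pow]
    simp
  have h0 : cw m ^ (l * t) ≠ 0 := by
    intro h
    rw [h, zero_mul] at h1
    exact zero_ne_one h1
  exact mul_left_cancel₀ h0 (h2.trans h1.symm)

lemma lam_lt_one {m q : ℕ} (hm : 0 < m) (hq : ¬ m ∣ q) : lam m q < 1 := by
  refine lt_of_le_of_ne (Real.cos_le_one _) fun h => hq ?_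
  have hn := norm_cw_pow m q
  have hre : (cw m ^ q).re = 1 := (cw_pow_re m q).trans h
  have him : (cw m ^ q).im = 0 := by
    have := Complex.sq_norm_sub_sq_re (cw m ^ q)
    rw [hn, hre] at this
    nlinarith
  have : cw m ^ q = 1 := Complex.ext hre him
  exact (Complex.isPrimitiveRoot_exp m hm.ne').dvd_of_pow_eq_one q this

lemma ucoef_addBall {m : ℕ} (q : ℕ) (w : Fin m → ℝ) (j : Fin m) :
    ucoef m q (addBall w j) = ucoef m q w + cw m ^ (q * ((j : ℕ) + 1)) := by
  have hm : 0 < m := j.pos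
  unfold ucoef addBall
  simp only [Complex.ofReal_add, mul_add, Finset.sum_add_distrib]
  congr 1
  rw [Finset.sum_eq_single ⟨((j : ℕ) + 1) % m, Nat.mod_lt _ hm⟩]
  · simp [cw_pow_mod hm, mul_add]
  · intro b _ hb
    rw [if_neg]
    · simp
    · intro h
      exact hb (Fin.ext h)
  · simp

lemma ucoef_sub {m : ℕ} (q : ℕ) (w w' : Fin m → ℝ) :
    ucoef m q (fun t => w t - w' t) = ucoef m q w - ucoef m q w' := by
  simp [ucoef, mul_sub, Finset.sum_sub_distrib]

lemma continuous_ucoef (m q : ℕ) : Continuous (ucoef m q) := by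
  unfold ucoef
  fun_prop

lemma norm_ucoef_le {m : ℕ} (q : ℕ) {w : Fin m → ℝ} (hw : ∀ i, 0 ≤ w i) :
    ‖ucoef m q w‖ ≤ ∑ i, w i := by
  refine (norm_sum_le _ _).trans (Finset.sum_le_sum fun i _ => ?_)
  rw [norm_mul, norm_cw_pow, one_mul, Complex.norm_real, Real.norm_of_nonneg (hw i)]

lemma sum_mul_cw_pow {m : ℕ} (q : ℕ) (w : Fin m → ℝ) (s : ℝ) :
    ∑ j, ((w j / s : ℝ) : ℂ) * cw m ^ (q * ((j : ℕ) + 1)) = cw m ^ q * (ucoef m q w / s) := by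
  rw [ucoef, Finset.sum_div, Finset.mul_sum]
  refine Finset.sum_congr rfl fun j _ => ?_
  rw [mul_add, pow_add, mul_one]
  push_cast
  ring

lemma tendsto_div_sq_of_recursion {x : ℕ → ℝ} {lm : ℝ} (hlm : lm < 1) (hx : ∀ n, 0 ≤ x n)
    (hrec : ∀ n, x (n + 1) ≤ (1 + 2 * lm / (n + 1)) * x n + 1) :
    Tendsto (fun n : ℕ => x n / ((n : ℝ) + 1) ^ 2) atTop (𝓝 0) := by
  set b := max lm (3 / 4) with hb
  have hb1 : b < 1 := max_lt hlm (by norm_num)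
  have hb2 : 3 / 4 ≤ b := le_max_right _ _
  have hlb : lm ≤ b := le_max_left _ _
  have key : ∀ n : ℕ, x n + 2 * (n + 1) ≤ (x 0 + 2) * ((n : ℝ) + 1) ^ (2 * b) := by
    intro n
    induction n with
    | zero => simp
    | succ n ih =>
      have hn : (0 : ℝ) < n + 1 := by positivity
      have h1 : (1 + 2 * lm / (n + 1)) * x n ≤ (1 + 2 * b / (n + 1)) * x n := by
        have := hx n
        gcongr
      have h2 : (1 + 2 * b / (n + 1)) * (2 * ((n : ℝ) + 1)) = 2 * (n + 1) + 4 * b := by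
        field_simp
        ring
      have h3 : x (n + 1) + 2 * ((n + 1 : ℕ) + 1) ≤
          (1 + 2 * b / (n + 1)) * (x n + 2 * (n + 1)) := by
        rw [mul_add _ (x n), h2]
        push_cast
        linarith [hrec n]
      have h4 : 1 + 2 * b / (n + 1) ≤ (1 + 1 / ((n : ℝ) + 1)) ^ (2 * b) := by
        have := one_add_mul_self_le_rpow_one_add (s := 1 / ((n : ℝ) + 1)) (p := 2 * b)
          (by have : 0 ≤ 1 / ((n : ℝ) + 1) := by positivity
              linarith) (by linarith)
        rwa [mul_one_div] at this
      have h5 : (1 + 1 / ((n : ℝ) + 1)) ^ (2 * b) * ((n : ℝ) + 1) ^ (2 * b) =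
          (((n + 1 : ℕ) : ℝ) + 1) ^ (2 * b) := by
        rw [← Real.mul_rpow (by positivity) (by positivity)]
        congr 1
        push_cast
        field_simp
      have h6 : 0 ≤ 1 + 2 * b / ((n : ℝ) + 1) := by positivity
      calc x (n + 1) + 2 * ((n + 1 : ℕ) + 1) ≤ (1 + 2 * b / (n + 1)) * (x n + 2 * (n + 1)) := h3
        _ ≤ (1 + 2 * b / (n + 1)) * ((x 0 + 2) * ((n : ℝ) + 1) ^ (2 * b)) := by gcongr
        _ ≤ (1 + 1 / ((n : ℝ) + 1)) ^ (2 * b) * ((x 0 + 2) * ((n : ℝ) + 1) ^ (2 * b)) := by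
          have := hx 0
          gcongr
        _ = _ := by rw [← h5]; ring
  have hlim : Tendsto (fun n : ℕ => (x 0 + 2) * ((n : ℝ) + 1) ^ (-(2 - 2 * b))) atTop
      (𝓝 ((x 0 + 2) * 0)) := by
    refine Tendsto.const_mul _ ?_
    exact (tendsto_rpow_neg_atTop (by linarith)).comp
      (tendsto_atTop_add_const_right _ _ tendsto_natCast_atTop_atTop)
  rw [mul_zero] at hlim
  refine squeeze_zero (fun n => div_nonneg (hx n) (by positivity)) (fun n => ?_) hlim
  have hn : (0 : ℝ) < n + 1 := by positivity
  rw [div_le_iff₀ (by positivity), mul_assoc, ← Real.rpow_natCast (_ : ℝ) 2, ← Real.rpow_add hn]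
  have e : -(2 - 2 * b) + ((2 : ℕ) : ℝ) = 2 * b := by push_cast; ring
  rw [e]
  have := key n
  linarith

section Urn

variable {Ω : Type*} [mΩ : MeasurableSpace Ω] {μ : Measure Ω} {m : ℕ} {j0 : Fin m}
  {R : ℕ → Ω → Fin m → ℝ}

namespace IsCyclicUrn

lemma integrable_comp (hR : IsCyclicUrn μ m j0 R) (n : ℕ) {E : Type*} [NormedAddCommGroup E]
    {f : (Fin m → ℝ) → E} (hf : StronglyMeasurable f) (C : ℝ)
    (hC : ∀ w : Fin m → ℝ, (∀ i, 0 ≤ w i) → ∑ i, w i = n + 1 → ‖f w‖ ≤ C) :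
    Integrable (fun ω => f (R n ω)) μ := by
  have := hR.isProb
  refine Integrable.of_bound (hf.comp_measurable (hR.meas n)).aestronglyMeasurable C ?_
  filter_upwards [hR.ae_sum_eq n] with ω hω
  exact hC _ (hR.nonneg n ω) hω

lemma integrable_ucoef (hR : IsCyclicUrn μ m j0 R) (n q : ℕ) :
    Integrable (fun ω => ucoef m q (R n ω)) μ :=
  hR.integrable_comp n (continuous_ucoef m q).stronglyMeasurable (n + 1)
    fun _ hw hs => (norm_ucoef_le q hw).trans hs.le

lemma integrable_normSq_ucoef (hR : IsCyclicUrn μ m j0 R) (n q : ℕ) :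
    Integrable (fun ω => ‖ucoef m q (R n ω)‖ ^ 2) μ :=
  hR.integrable_comp n (by have := continuous_ucoef m q; exact (by fun_prop :
    Continuous fun w => ‖ucoef m q w‖ ^ 2).stronglyMeasurable) ((n + 1) ^ 2) fun w hw hs => by
      rw [Real.norm_of_nonneg (by positivity)]
      have := (norm_ucoef_le q hw).trans hs.le
      gcongr

lemma stronglyMeasurable_comp {i n : ℕ} (hin : i ≤ n)
    {E : Type*} [TopologicalSpace E] {f : (Fin m → ℝ) → E} (hf : StronglyMeasurable f) :
    StronglyMeasurable[urnFilt m R n] (fun ω => f (R i ω)) :=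
  hf.comp_measurable (measurable_filt hin)

lemma integral_ucoef_succ (hR : IsCyclicUrn μ m j0 R) (n q : ℕ) :
    ∫ ω, ucoef m q (R (n + 1) ω) ∂μ =
      (1 + cw m ^ q / (n + 1)) * ∫ ω, ucoef m q (R n ω) ∂μ := by
  have := hR.isProb
  rw [hR.integral_step n (h := fun j ω => ucoef m q (R n ω) + cw m ^ (q * ((j : ℕ) + 1)))
    (fun j => stronglyMeasurable_comp le_rfl
      (by have := continuous_ucoef m q; exact (by fun_prop :
        Continuous fun w => ucoef m q w + cw m ^ (q * ((j : ℕ) + 1))).stronglyMeasurable))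
    (fun j => (hR.integrable_ucoef n q).add (integrable_const _))
    (ae_of_all _ fun ω j hj => by rw [hj, ucoef_addBall]), ← integral_const_mul]
  refine integral_congr_ae ?_
  filter_upwards [hR.ae_sum_eq n] with ω hω
  simp_rw [mul_add (Complex.ofReal _)]
  rw [Finset.sum_add_distrib, sum_mul_cw_pow, ← Finset.sum_mul, ← Complex.ofReal_sum,
    ← Finset.sum_div, hω, div_self (by positivity)]
  push_cast
  ring

lemma integral_normSq_ucoef_succ (hR : IsCyclicUrn μ m j0 R) (n q : ℕ) :
    ∫ ω, ‖ucoef m q (R (n + 1) ω)‖ ^ 2 ∂μ =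
      (1 + 2 * lam m q / (n + 1)) * ∫ ω, ‖ucoef m q (R n ω)‖ ^ 2 ∂μ + 1 := by
  have := hR.isProb
  have hstep := hR.integral_step n (X := fun ω => ((‖ucoef m q (R (n + 1) ω)‖ ^ 2 : ℝ) : ℂ))
    (h := fun j ω => ((‖ucoef m q (addBall (R n ω) j)‖ ^ 2 : ℝ) : ℂ))
    (fun j => stronglyMeasurable_comp le_rfl
      (f := fun w => ((‖ucoef m q (addBall w j)‖ ^ 2 : ℝ) : ℂ))
      (by
        simp_rw [ucoef_addBall]
        have := continuous_ucoef m q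
        exact (by fun_prop : Continuous fun w =>
          ((‖ucoef m q w + cw m ^ (q * ((j : ℕ) + 1))‖ ^ 2 : ℝ) : ℂ)).stronglyMeasurable))
    (fun j => hR.integrable_comp n
      (f := fun w => ((‖ucoef m q (addBall w j)‖ ^ 2 : ℝ) : ℂ))
      (by
        simp_rw [ucoef_addBall]
        have := continuous_ucoef m q
        exact (by fun_prop : Continuous fun w =>
          ((‖ucoef m q w + cw m ^ (q * ((j : ℕ) + 1))‖ ^ 2 : ℝ) : ℂ)).stronglyMeasurable)
      ((n + 1 + 1) ^ 2) fun w hw hs => by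
        rw [Complex.norm_real, Real.norm_of_nonneg (by positivity), ucoef_addBall]
        have h1 := (norm_ucoef_le q hw).trans hs.le
        have h2 := norm_add_le (ucoef m q w) (cw m ^ (q * ((j : ℕ) + 1)))
        rw [norm_cw_pow] at h2
        have h3 : ‖ucoef m q w + cw m ^ (q * ((j : ℕ) + 1))‖ ≤ n + 1 + 1 := by linarith
        gcongr)
    (ae_of_all _ fun ω j hj => by rw [hj])
  rw [integral_complex_ofReal] at hstep
  have hptw : (fun ω => ∑ j, ((R n ω j / (n + 1) : ℝ) : ℂ) *
      ((‖ucoef m q (addBall (R n ω) j)‖ ^ 2 : ℝ) : ℂ)) =ᵐ[μ]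
      fun ω => (((1 + 2 * lam m q / (n + 1)) * ‖ucoef m q (R n ω)‖ ^ 2 + 1 : ℝ) : ℂ) := by
    filter_upwards [hR.ae_sum_eq n] with ω hω
    rw [← Complex.ofReal_inj.2 (show ∑ j, (R n ω j / (n + 1)) *
      ‖ucoef m q (addBall (R n ω) j)‖ ^ 2 = _ from ?_)]
    · push_cast; rfl
    have e : ∀ j : Fin m, ‖ucoef m q (addBall (R n ω) j)‖ ^ 2 = (‖ucoef m q (R n ω)‖ ^ 2 + 1) +
        2 * ((starRingEnd ℂ) (ucoef m q (R n ω)) * cw m ^ (q * ((j : ℕ) + 1))).re := by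
      intro j
      rw [ucoef_addBall, ← Complex.normSq_eq_norm_sq, Complex.normSq_add, Complex.normSq_eq_norm_sq,
        Complex.normSq_eq_norm_sq, norm_cw_pow, ← Complex.conj_re (_ * (starRingEnd ℂ) _), map_mul,
        Complex.conj_conj]
      ring
    simp_rw [e, mul_add (R n ω _ / _)]
    rw [Finset.sum_add_distrib, Finset.sum_add_distrib, ← Finset.sum_mul, ← Finset.sum_mul,
      ← Finset.sum_div, hω, div_self (by positivity)]
    have e2 : ∑ j, R n ω j / ((n : ℝ) + 1) * (2 * ((starRingEnd ℂ) (ucoef m q (R n ω)) *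
        cw m ^ (q * ((j : ℕ) + 1))).re) = 2 * ((starRingEnd ℂ) (ucoef m q (R n ω)) *
        ∑ j, ((R n ω j / ((n : ℝ) + 1) : ℝ) : ℂ) * cw m ^ (q * ((j : ℕ) + 1))).re := by
      rw [Finset.mul_sum, Complex.re_sum, Finset.mul_sum]
      refine Finset.sum_congr rfl fun j _ => ?_
      rw [mul_left_comm ((starRingEnd ℂ) _), Complex.re_ofReal_mul]
      ring
    rw [e2, sum_mul_cw_pow]
    have e3 : (starRingEnd ℂ) (ucoef m q (R n ω)) *
        (cw m ^ q * (ucoef m q (R n ω) / (((n : ℝ) + 1 : ℝ) : ℂ))) =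
        ((‖ucoef m q (R n ω)‖ ^ 2 / (n + 1) : ℝ) : ℂ) * cw m ^ q := by
      rw [mul_left_comm, ← mul_div_assoc, mul_comm ((starRingEnd ℂ) _), Complex.mul_conj,
        Complex.normSq_eq_norm_sq]
      push_cast
      ring
    rw [e3, Complex.re_ofReal_mul, cw_pow_re]
    ring
  rw [integral_congr_ae hptw, integral_complex_ofReal] at hstep
  have h2 := Complex.ofReal_injective hstep
  rw [h2, integral_add ((hR.integrable_normSq_ucoef n q).const_mul _) (integrable_const _),
    integral_const_mul]
  simp

/-- The normalized discrete Fourier coefficients of the urn vanish in the limit. -/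
lemma tendsto_integral_norm_ucoef (hR : IsCyclicUrn μ m j0 R) {q : ℕ} (hq : ¬ m ∣ q) :
    Tendsto (fun n : ℕ => ∫ ω, ‖ucoef m q (R n ω)‖ / (n + 1) ∂μ) atTop (𝓝 0) := by
  have := hR.isProb
  have h1 := tendsto_div_sq_of_recursion (x := fun n => ∫ ω, ‖ucoef m q (R n ω)‖ ^ 2 ∂μ)
    (lam_lt_one j0.pos hq) (fun n => integral_nonneg fun ω => by positivity)
    (fun n => (hR.integral_normSq_ucoef_succ n q).le)
  have h2 := h1.sqrt
  rw [Real.sqrt_zero] at h2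
  refine squeeze_zero (fun n => integral_nonneg fun ω => by positivity) (fun n => ?_) h2
  rw [integral_div, Real.sqrt_div (integral_nonneg fun ω => by positivity),
    Real.sqrt_sq (by positivity)]
  gcongr
  refine Real.le_sqrt_of_sq_le ?_
  have hL : MemLp (fun ω => ‖ucoef m q (R n ω)‖) 2 μ :=
    (memLp_two_iff_integrable_sq (hR.integrable_ucoef n q).norm.aestronglyMeasurable).2
      (hR.integrable_normSq_ucoef n q)
  have hv := variance_eq_sub hL
  have hn := variance_nonneg (fun ω => ‖ucoef m q (R n ω)‖) μ
  rw [hv] at hn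
  simp only [Pi.pow_apply] at hn
  linarith

end IsCyclicUrn
end Urn

lemma re_sq_eq (z : ℂ) : z.re ^ 2 = (z * z + z * (starRingEnd ℂ) z).re / 2 := by
  simp only [Complex.add_re, Complex.mul_re, Complex.conj_re, Complex.conj_im]
  ring

lemma sum_mul_sq_sub {ι : Type*} [Fintype ι] (p x : ι → ℝ) (hp : ∑ j, p j = 1) :
    ∑ j, p j * (x j - ∑ i, p i * x i) ^ 2 = ∑ j, p j * x j ^ 2 - (∑ j, p j * x j) ^ 2 := by
  set c := ∑ i, p i * x i with hc
  have : ∀ j, p j * (x j - c) ^ 2 = p j * x j ^ 2 - 2 * c * (p j * x j) + c ^ 2 * p j := by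
    intro j; ring
  simp_rw [this]
  rw [Finset.sum_add_distrib, Finset.sum_sub_distrib, ← Finset.mul_sum, ← Finset.mul_sum, hp, ← hc]
  ring

/-- The limiting conditional variance of a linear combination of the Fourier coefficients. -/
def limVar (m : ℕ) (a : ℕ → ℂ) : ℝ :=
  (∑ k ∈ Finset.Icc 1 (m / 2), ‖a k‖ ^ 2 + (a (m / 2) ^ 2).re) / 2

/-- The total weight of a linear combination of the Fourier coefficients. -/
def totalWeight (m : ℕ) (a : ℕ → ℂ) : ℝ := ∑ k ∈ Finset.Icc 1 (m / 2), ‖a k‖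

lemma totalWeight_nonneg (m : ℕ) (a : ℕ → ℂ) : 0 ≤ totalWeight m a :=
  Finset.sum_nonneg fun _ _ => norm_nonneg _

lemma norm_le_totalWeight {m : ℕ} (hm : 2 ≤ m) (a : ℕ → ℂ) : ‖a (m / 2)‖ ≤ totalWeight m a :=
  Finset.single_le_sum (f := fun k => ‖a k‖) (fun _ _ => norm_nonneg _)
    (Finset.mem_Icc.2 ⟨by omega, le_rfl⟩)

lemma sum_norm_sq_le_totalWeight_sq (m : ℕ) (a : ℕ → ℂ) :
    ∑ k ∈ Finset.Icc 1 (m / 2), ‖a k‖ ^ 2 ≤ totalWeight m a ^ 2 :=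
  Finset.sum_sq_le_sq_sum_of_nonneg fun _ _ => norm_nonneg _

lemma limVar_le {m : ℕ} (hm : 2 ≤ m) (a : ℕ → ℂ) : limVar m a ≤ totalWeight m a ^ 2 := by
  have h1 := sum_norm_sq_le_totalWeight_sq m a
  have h2 : (a (m / 2) ^ 2).re ≤ totalWeight m a ^ 2 := by
    refine (Complex.re_le_norm _).trans ?_
    rw [norm_pow]
    have := norm_le_totalWeight hm a
    gcongr
  rw [limVar]
  linarith

lemma limVar_nonneg {m : ℕ} (hm : 2 ≤ m) (a : ℕ → ℂ) : 0 ≤ limVar m a := by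
  have h1 : ‖a (m / 2)‖ ^ 2 ≤ ∑ k ∈ Finset.Icc 1 (m / 2), ‖a k‖ ^ 2 :=
    Finset.single_le_sum (f := fun k => ‖a k‖ ^ 2) (fun _ _ => by positivity)
      (Finset.mem_Icc.2 ⟨by omega, le_rfl⟩)
  have h2 := (abs_le.1 (Complex.abs_re_le_norm (a (m / 2) ^ 2))).1
  rw [norm_pow] at h2
  rw [limVar]
  linarith

section Weights

variable {m : ℕ} {p : Fin m → ℝ}

/-- The mean of `ω ^ (q (j + 1))` when `j` is drawn with weights `p`. -/
def fourierMean (p : Fin m → ℝ) (q : ℕ) : ℂ := ∑ j : Fin m, (p j : ℂ) * cw m ^ (q * ((j : ℕ) + 1))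

lemma norm_fourierMean_le_one (hp : ∀ j, 0 ≤ p j) (hs : ∑ j, p j = 1) (q : ℕ) :
    ‖fourierMean p q‖ ≤ 1 := by
  rw [← hs]
  refine (norm_sum_le _ _).trans (Finset.sum_le_sum fun j _ => ?_)
  rw [norm_mul, norm_cw_pow, mul_one, Complex.norm_real, Real.norm_of_nonneg (hp j)]

lemma fourierMean_of_dvd (hm : 0 < m) (hs : ∑ j, p j = 1) {q : ℕ} (hq : m ∣ q) :
    fourierMean p q = 1 := by
  obtain ⟨c, rfl⟩ := hq
  simp only [fourierMean, mul_assoc, pow_mul _ m, cw_pow_self hm, one_pow, mul_one]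
  rw [← Complex.ofReal_sum, hs, Complex.ofReal_one]

/-- The increment of the linear combination with coefficients `a` when a ball of type `j`
is drawn. -/
def incr (p : Fin m → ℝ) (a : ℕ → ℂ) (j : Fin m) : ℝ :=
  (∑ k ∈ Finset.Icc 1 (m / 2), a k * (cw m ^ (k * ((j : ℕ) + 1)) - fourierMean p k)).re

/-- The uncentered increment. -/
def rawIncr (m : ℕ) (a : ℕ → ℂ) (j : Fin m) : ℂ :=
  ∑ k ∈ Finset.Icc 1 (m / 2), a k * cw m ^ (k * ((j : ℕ) + 1))

lemma sum_mul_rawIncr (a : ℕ → ℂ) :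
    ∑ j, (p j : ℂ) * rawIncr m a j = ∑ k ∈ Finset.Icc 1 (m / 2), a k * fourierMean p k := by
  simp only [rawIncr, fourierMean, Finset.mul_sum]
  rw [Finset.sum_comm]
  exact Finset.sum_congr rfl fun k _ => Finset.sum_congr rfl fun j _ => by ring

lemma sum_mul_rawIncr_re (a : ℕ → ℂ) :
    ∑ j, p j * (rawIncr m a j).re =
      (∑ k ∈ Finset.Icc 1 (m / 2), a k * fourierMean p k).re := by
  rw [← sum_mul_rawIncr, Complex.re_sum]
  simp

lemma incr_eq (a : ℕ → ℂ) (j : Fin m) :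
    incr p a j = (rawIncr m a j).re - ∑ i, p i * (rawIncr m a i).re := by
  rw [sum_mul_rawIncr_re, ← Complex.sub_re, rawIncr, ← Finset.sum_sub_distrib, incr]
  simp_rw [mul_sub]

lemma sum_mul_incr (hs : ∑ j, p j = 1) (a : ℕ → ℂ) : ∑ j, p j * incr p a j = 0 := by
  simp_rw [incr_eq, mul_sub]
  rw [Finset.sum_sub_distrib, ← Finset.sum_mul, hs]
  ring

lemma abs_incr_le (hp : ∀ j, 0 ≤ p j) (hs : ∑ j, p j = 1) (a : ℕ → ℂ) (j : Fin m) :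
    |incr p a j| ≤ 2 * totalWeight m a := by
  refine (Complex.abs_re_le_norm _).trans ((norm_sum_le _ _).trans ?_)
  rw [totalWeight, Finset.mul_sum]
  refine Finset.sum_le_sum fun k _ => ?_
  rw [norm_mul, mul_comm]
  gcongr
  refine (norm_sub_le _ _).trans ?_
  rw [norm_cw_pow]
  linarith [norm_fourierMean_le_one hp hs k]

lemma norm_sum_sum_mul_le (a b : ℕ → ℂ) (c : ℕ → ℕ → ℂ) {δ : ℝ} (s : Finset ℕ)
    (hb : ∀ k, ‖b k‖ = ‖a k‖) (h : ∀ k ∈ s, ∀ l ∈ s, ‖c k l‖ ≤ δ) :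
    ‖∑ k ∈ s, ∑ l ∈ s, a k * b l * c k l‖ ≤ (∑ k ∈ s, ‖a k‖) ^ 2 * δ := by
  rw [sq, Finset.sum_mul_sum, Finset.sum_mul]
  refine (norm_sum_le _ _).trans (Finset.sum_le_sum fun k hk => ?_)
  rw [Finset.sum_mul]
  refine (norm_sum_le _ _).trans (Finset.sum_le_sum fun l hl => ?_)
  rw [norm_mul, norm_mul, hb]
  have := h k hk l hl
  gcongr

lemma abs_sum_mul_incr_sq_sub_le (hm : 2 ≤ m) (h2 : 2 ∣ m) (hp : ∀ j, 0 ≤ p j)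
    (hs : ∑ j, p j = 1) (a : ℕ → ℂ) {δ : ℝ}
    (hδ : ∀ q < 2 * m, ¬ m ∣ q → ‖fourierMean p q‖ ≤ δ) :
    |∑ j, p j * incr p a j ^ 2 - limVar m a| ≤ 2 * totalWeight m a ^ 2 * δ := by
  have hm0 : 0 < m := by omega
  have hδ0 : 0 ≤ δ := (norm_nonneg _).trans (hδ 1 (by omega) fun h => by
    have := Nat.le_of_dvd one_pos h
    omega)
  set s := Finset.Icc 1 (m / 2) with hsdef
  have hA0 := totalWeight_nonneg m a
  have e1 : ∑ j, (p j : ℂ) * (rawIncr m a j * rawIncr m a j) =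
      ∑ k ∈ s, ∑ l ∈ s, a k * a l * fourierMean p (k + l) := by
    simp only [rawIncr, Finset.sum_mul_sum]
    simp only [fourierMean, Finset.mul_sum]
    rw [Finset.sum_comm]
    refine Finset.sum_congr rfl fun k _ => ?_
    rw [Finset.sum_comm]
    refine Finset.sum_congr rfl fun l _ => Finset.sum_congr rfl fun j _ => ?_
    rw [add_mul k l, pow_add]
    ring
  have e2 : ∑ j, (p j : ℂ) * (rawIncr m a j * (starRingEnd ℂ) (rawIncr m a j)) =
      ∑ k ∈ s, ∑ l ∈ s, a k * (starRingEnd ℂ) (a l) * fourierMean p (k + (m - l)) := by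
    simp only [rawIncr, map_sum, Finset.sum_mul_sum]
    simp only [fourierMean, Finset.mul_sum]
    rw [Finset.sum_comm]
    refine Finset.sum_congr rfl fun k _ => ?_
    rw [Finset.sum_comm]
    refine Finset.sum_congr rfl fun l hl => Finset.sum_congr rfl fun j _ => ?_
    have hlm : l ≤ m := by have := (Finset.mem_Icc.1 hl).2; omega
    rw [add_mul k (m - l), pow_add, map_mul, conj_cw_pow hm0 hlm]
    ring
  have f1 : ‖∑ k ∈ s, ∑ l ∈ s, a k * a l * fourierMean p (k + l) - a (m / 2) ^ 2‖ ≤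
      totalWeight m a ^ 2 * δ := by
    have hmem : m / 2 ∈ s := Finset.mem_Icc.2 ⟨by omega, le_rfl⟩
    have : a (m / 2) ^ 2 = ∑ k ∈ s, ∑ l ∈ s, a k * a l * (if m ∣ k + l then 1 else 0) := by
      rw [Finset.sum_eq_single_of_mem _ hmem, Finset.sum_eq_single_of_mem _ hmem]
      · rw [if_pos ⟨1, by omega⟩]; ring
      · intro l hl hne
        have := Finset.mem_Icc.1 hl
        rw [if_neg, mul_zero]
        intro h
        have := Nat.le_of_dvd (by omega) h
        omega
      · intro k hk hne
        refine Finset.sum_eq_zero fun l hl => ?_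
        have := Finset.mem_Icc.1 hl
        have := Finset.mem_Icc.1 hk
        rw [if_neg, mul_zero]
        intro h
        have := Nat.le_of_dvd (by omega) h
        omega
    rw [this, ← Finset.sum_sub_distrib]
    simp_rw [← Finset.sum_sub_distrib, ← mul_sub]
    refine norm_sum_sum_mul_le a a _ s (fun _ => rfl) fun k hk l hl => ?_
    have h1 := Finset.mem_Icc.1 hl
    have h2 := Finset.mem_Icc.1 hk
    split_ifs with h
    · rw [fourierMean_of_dvd hm0 hs h]; simpa using hδ0
    · rw [sub_zero]; exact hδ _ (by omega) h
  have f2 : ‖∑ k ∈ s, ∑ l ∈ s, a k * (starRingEnd ℂ) (a l) * fourierMean p (k + (m - l)) -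
      ((∑ k ∈ s, ‖a k‖ ^ 2 : ℝ) : ℂ)‖ ≤ totalWeight m a ^ 2 * δ := by
    have : ((∑ k ∈ s, ‖a k‖ ^ 2 : ℝ) : ℂ) =
        ∑ k ∈ s, ∑ l ∈ s, a k * (starRingEnd ℂ) (a l) * (if k = l then 1 else 0) := by
      rw [Complex.ofReal_sum]
      refine Finset.sum_congr rfl fun k hk => ?_
      rw [Finset.sum_eq_single_of_mem k hk]
      · rw [if_pos rfl, Complex.mul_conj, Complex.normSq_eq_norm_sq, mul_one]
      · intro l _ hne
        rw [if_neg hne.symm, mul_zero]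
    rw [this, ← Finset.sum_sub_distrib]
    simp_rw [← Finset.sum_sub_distrib, ← mul_sub]
    refine norm_sum_sum_mul_le a (fun k => (starRingEnd ℂ) (a k)) _ s
      (fun _ => RCLike.norm_conj _) fun k hk l hl => ?_
    have h1 := Finset.mem_Icc.1 hl
    have h2 := Finset.mem_Icc.1 hk
    split_ifs with h
    · rw [fourierMean_of_dvd hm0 hs (by rw [h, Nat.add_sub_cancel' (by omega)])]; simpa using hδ0
    · rw [sub_zero]
      refine hδ _ (by omega) fun ⟨c, hc⟩ => ?_
      have : c = 1 := by
        rcases Nat.lt_or_ge c 1 with h' | h'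
        · interval_cases c; omega
        · rcases Nat.lt_or_ge c 2 with h'' | h''
          · omega
          · have := Nat.mul_le_mul_left m h''
            omega
      subst this
      omega
  have f3 : (∑ j, p j * (rawIncr m a j).re) ^ 2 ≤ totalWeight m a ^ 2 * δ := by
    rw [sum_mul_rawIncr_re]
    set z := ∑ k ∈ s, a k * fourierMean p k with hz
    have g1 : ‖z‖ ≤ totalWeight m a * δ := by
      rw [totalWeight, Finset.sum_mul]
      refine (norm_sum_le _ _).trans (Finset.sum_le_sum fun k hk => ?_)
      rw [norm_mul]
      have := Finset.mem_Icc.1 hk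
      have := hδ k (by omega) fun h => by
        have := Nat.le_of_dvd (by omega) h
        omega
      gcongr
    have g2 : ‖z‖ ≤ totalWeight m a := by
      refine (norm_sum_le _ _).trans (Finset.sum_le_sum fun k hk => ?_)
      rw [norm_mul]
      exact mul_le_of_le_one_right (norm_nonneg _) (norm_fourierMean_le_one hp hs k)
    have g3 : z.re ^ 2 ≤ ‖z‖ * ‖z‖ := by
      have := Complex.abs_re_le_norm z
      rw [← sq_abs, ← sq]
      gcongr
    calc z.re ^ 2 ≤ ‖z‖ * ‖z‖ := g3
      _ ≤ totalWeight m a * (totalWeight m a * δ) := by gcongr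
      _ = _ := by ring
  have e3 : ∑ j, p j * (rawIncr m a j).re ^ 2 =
      (∑ k ∈ s, ∑ l ∈ s, a k * a l * fourierMean p (k + l) +
      ∑ k ∈ s, ∑ l ∈ s, a k * (starRingEnd ℂ) (a l) * fourierMean p (k + (m - l))).re / 2 := by
    rw [← e1, ← e2, ← Finset.sum_add_distrib, Complex.re_sum, Finset.sum_div]
    refine Finset.sum_congr rfl fun j _ => ?_
    rw [re_sq_eq, ← mul_add (p j : ℂ), Complex.re_ofReal_mul]
    ring
  simp_rw [incr_eq]
  rw [sum_mul_sq_sub p _ hs, e3, limVar]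
  have g1 := (Complex.abs_re_le_norm _).trans f1
  have g2 := (Complex.abs_re_le_norm _).trans f2
  rw [Complex.sub_re] at g1 g2
  rw [Complex.ofReal_re] at g2
  rw [Complex.add_re]
  rw [abs_le] at g1 g2 ⊢
  have := sq_nonneg (∑ j, p j * (rawIncr m a j).re)
  constructor <;> linarith [g1.1, g1.2, g2.1, g2.2]

lemma norm_exp_mul_I_sub_le {x : ℝ} (hx : |x| ≤ 1) :
    ‖Complex.exp (x * I) - (1 + x * I - (x : ℂ) ^ 2 / 2)‖ ≤ |x| ^ 3 * (2 / 9) := by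
  have h := Complex.exp_bound (x := x * I) (n := 3) (by simpa using hx) (by norm_num)
  have e : ∑ i ∈ Finset.range 3, ((x : ℂ) * I) ^ i / (i.factorial : ℂ) =
      1 + x * I - (x : ℂ) ^ 2 / 2 := by
    simp [Finset.sum_range_succ, mul_pow, Nat.factorial]
    ring
  rw [e] at h
  refine h.trans (le_of_eq ?_)
  simp [Nat.factorial]
  norm_num

lemma abs_exp_neg_half_sub_le {v : ℝ} (h0 : 0 ≤ v) (h1 : v ≤ 1) :
    |Real.exp (-v / 2) - (1 - v / 2)| ≤ v ^ 2 * (3 / 16) := by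
  have h := Real.exp_bound (x := -v / 2) (n := 2)
    (by rw [abs_le]; constructor <;> linarith) (by norm_num)
  have e : ∑ i ∈ Finset.range 2, (-v / 2) ^ i / (i.factorial : ℝ) = 1 - v / 2 := by
    simp [Finset.sum_range_succ]
    ring
  rw [e, sq_abs] at h
  refine h.trans (le_of_eq ?_)
  simp [Nat.factorial]
  ring

/-- One-step comparison of the conditional characteristic function with a Gaussian one. -/
lemma norm_sum_mul_exp_incr_sub_le (hm : 2 ≤ m) (h2 : 2 ∣ m) (hp : ∀ j, 0 ≤ p j)
    (hs : ∑ j, p j = 1) (a : ℕ → ℂ) (ha : totalWeight m a ≤ 1 / 2) {δ : ℝ}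
    (hδ : ∀ q < 2 * m, ¬ m ∣ q → ‖fourierMean p q‖ ≤ δ) :
    ‖∑ j, (p j : ℂ) * Complex.exp (incr p a j * I) - (Real.exp (-limVar m a / 2) : ℂ)‖ ≤
      totalWeight m a ^ 2 * (δ + 2 * totalWeight m a) := by
  set A := totalWeight m a with hA
  have hA0 : 0 ≤ A := totalWeight_nonneg m a
  have hd : ∀ j, |incr p a j| ≤ 2 * A := abs_incr_le hp hs a
  have t1 : ‖∑ j, (p j : ℂ) * Complex.exp (incr p a j * I) -
      ∑ j, (p j : ℂ) * (1 + incr p a j * I - (incr p a j : ℂ) ^ 2 / 2)‖ ≤ (2 * A) ^ 3 * (2 / 9) := by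
    rw [← Finset.sum_sub_distrib]
    calc _ ≤ ∑ j, p j * ((2 * A) ^ 3 * (2 / 9)) := by
          refine (norm_sum_le _ _).trans (Finset.sum_le_sum fun j _ => ?_)
          rw [← mul_sub, norm_mul, Complex.norm_real, Real.norm_of_nonneg (hp j)]
          refine mul_le_mul_of_nonneg_left ?_ (hp j)
          refine (norm_exp_mul_I_sub_le ((hd j).trans (by linarith))).trans ?_
          have := hd j
          gcongr
      _ = _ := by rw [← Finset.sum_mul, hs, one_mul]
  have t2 : ∑ j, (p j : ℂ) * (1 + incr p a j * I - (incr p a j : ℂ) ^ 2 / 2) =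
      ((1 - (∑ j, p j * incr p a j ^ 2) / 2 : ℝ) : ℂ) := by
    have : ∀ j, (p j : ℂ) * (1 + incr p a j * I - (incr p a j : ℂ) ^ 2 / 2) =
        (p j : ℂ) + ((p j * incr p a j : ℝ) : ℂ) * I - ((p j * incr p a j ^ 2 : ℝ) : ℂ) / 2 := by
      intro j; push_cast; ring
    simp_rw [this]
    rw [Finset.sum_sub_distrib, Finset.sum_add_distrib, ← Finset.sum_mul, ← Finset.sum_div,
      ← Complex.ofReal_sum, ← Complex.ofReal_sum, ← Complex.ofReal_sum, sum_mul_incr hs, hs]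
    push_cast
    ring
  have t3 := abs_sum_mul_incr_sq_sub_le hm h2 hp hs a hδ
  have hV0 := limVar_nonneg hm a
  have hV1 : limVar m a ≤ A ^ 2 := limVar_le hm a
  have hA2 : A ^ 2 ≤ 1 / 4 := by nlinarith
  have t4 := abs_exp_neg_half_sub_le hV0 (by linarith)
  have t5 : ‖((1 - (∑ j, p j * incr p a j ^ 2) / 2 : ℝ) : ℂ) - (Real.exp (-limVar m a / 2) : ℂ)‖ ≤
      A ^ 2 * δ + A ^ 4 * (3 / 16) := by
    rw [← Complex.ofReal_sub, Complex.norm_real, Real.norm_eq_abs]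
    have hV2 : limVar m a ^ 2 ≤ A ^ 4 := by
      calc limVar m a ^ 2 ≤ (A ^ 2) ^ 2 := by gcongr
        _ = _ := by ring
    rw [abs_le] at t3 t4 ⊢
    constructor <;> linarith [t3.1, t3.2, t4.1, t4.2]
  rw [t2] at t1
  calc _ ≤ _ := norm_sub_le_norm_sub_add_norm_sub _
        ((1 - (∑ j, p j * incr p a j ^ 2) / 2 : ℝ) : ℂ) _
    _ ≤ (2 * A) ^ 3 * (2 / 9) + (A ^ 2 * δ + A ^ 4 * (3 / 16)) := add_le_add t1 t5
    _ ≤ _ := by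
      have : A ^ 4 ≤ A ^ 3 * (1 / 2) := by
        calc A ^ 4 = A ^ 3 * A := by ring
          _ ≤ _ := by gcongr
      have : 0 ≤ A ^ 3 := by positivity
      nlinarith

end Weights

/-- The martingale increment of the linear combination with coefficients `a` at step `j`. -/
def rowIncr {Ω : Type*} (m : ℕ) (R : ℕ → Ω → Fin m → ℝ) (a : ℕ → ℂ) (j : ℕ) (ω : Ω) : ℝ :=
  (∑ k ∈ Finset.Icc 1 (m / 2),
    a k * (ucoef m k (R (j + 1) ω) - (1 + cw m ^ k / (j + 1)) * ucoef m k (R j ω))).re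

/-- The sum of the first `N` martingale increments with coefficients `a j` at step `j`. -/
def rowSum {Ω : Type*} (m : ℕ) (R : ℕ → Ω → Fin m → ℝ) (a : ℕ → ℕ → ℂ) (N : ℕ) (ω : Ω) : ℝ :=
  ∑ j ∈ Finset.range N, rowIncr m R (a j) j ω

/-- The deviation of the composition at time `n` from the uniform one. -/
def mixErr {Ω : Type*} [MeasurableSpace Ω] (μ : Measure Ω) (m : ℕ) (R : ℕ → Ω → Fin m → ℝ)
    (n : ℕ) : ℝ :=
  ∑ q ∈ (Finset.range (2 * m)).filter (fun q => ¬ m ∣ q), ∫ ω, ‖ucoef m q (R n ω)‖ / (n + 1) ∂μ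

lemma continuous_incr {m : ℕ} (s : ℝ) (a : ℕ → ℂ) (j : Fin m) :
    Continuous fun w : Fin m → ℝ => incr (fun i => w i / s) a j := by
  unfold incr fourierMean
  fun_prop

lemma rowIncr_of_eq_addBall {Ω : Type*} {m : ℕ} {R : ℕ → Ω → Fin m → ℝ} (a : ℕ → ℂ) {n : ℕ}
    {ω : Ω} {j : Fin m} (h : R (n + 1) ω = addBall (R n ω) j) :
    rowIncr m R a n ω = incr (fun i => R n ω i / (n + 1)) a j := by
  rw [rowIncr, incr, h]
  congr 1
  refine Finset.sum_congr rfl fun k _ => ?_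
  rw [fourierMean, ucoef_addBall]
  have := sum_mul_cw_pow k (R n ω) (n + 1)
  rw [this]
  push_cast
  ring

namespace IsCyclicUrn

variable {Ω : Type*} [mΩ : MeasurableSpace Ω] {μ : Measure Ω} {m : ℕ} {j0 : Fin m}
  {R : ℕ → Ω → Fin m → ℝ}

lemma tendsto_mixErr (hR : IsCyclicUrn μ m j0 R) : Tendsto (mixErr μ m R) atTop (𝓝 0) := by
  rw [← Finset.sum_const_zero (s := (Finset.range (2 * m)).filter (fun q => ¬ m ∣ q))]
  exact tendsto_finsetSum _ fun q hq =>
    hR.tendsto_integral_norm_ucoef (Finset.mem_filter.1 hq).2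

lemma mixErr_nonneg (n : ℕ) : 0 ≤ mixErr μ m R n :=
  Finset.sum_nonneg fun _ _ => integral_nonneg fun _ => by positivity

lemma stronglyMeasurable_rowSum (a : ℕ → ℕ → ℂ) (N : ℕ) :
    StronglyMeasurable[urnFilt m R N] (rowSum m R a N) := by
  unfold rowSum rowIncr
  refine Finset.stronglyMeasurable_fun_sum _ fun j hj => ?_
  have hj := Finset.mem_range.1 hj
  refine Complex.continuous_re.comp_stronglyMeasurable ?_
  refine Finset.stronglyMeasurable_fun_sum _ fun k _ => ?_
  exact ((stronglyMeasurable_comp (by omega) (continuous_ucoef m k).stronglyMeasurable).sub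
    ((stronglyMeasurable_comp (by omega) (continuous_ucoef m k).stronglyMeasurable).const_mul
      _)).const_mul _

lemma stronglyMeasurable_exp_rowSum (a : ℕ → ℕ → ℂ) (N : ℕ) :
    StronglyMeasurable[urnFilt m R N] fun ω => Complex.exp (rowSum m R a N ω * I) :=
  Continuous.comp_stronglyMeasurable (g := fun x : ℝ => Complex.exp (x * I)) (by fun_prop)
    (stronglyMeasurable_rowSum a N)

lemma norm_integral_exp_rowSum_sub_le (hm : 2 ≤ m) (h2 : 2 ∣ m) (hR : IsCyclicUrn μ m j0 R)
    (a : ℕ → ℕ → ℂ) (ha : ∀ j, totalWeight m (a j) ≤ 1 / 2) (N : ℕ) :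
    ‖∫ ω, Complex.exp (rowSum m R a N ω * I) ∂μ -
      (Real.exp (-(∑ j ∈ Finset.range N, limVar m (a j)) / 2) : ℂ)‖ ≤
      ∑ j ∈ Finset.range N, totalWeight m (a j) ^ 2 * (mixErr μ m R j + 2 * totalWeight m (a j)) := by
  have := hR.isProb
  induction N with
  | zero => simp [rowSum]
  | succ N ih =>
    set A := totalWeight m (a N) with hA
    set L := ∑ j ∈ Finset.range N, limVar m (a j) with hL
    set e : Ω → ℂ := fun ω => Complex.exp (rowSum m R a N ω * I) with he
    set p : Ω → Fin m → ℝ := fun ω i => R N ω i / (N + 1) with hp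
    set Φ : Ω → ℂ := fun ω => ∑ j, (p ω j : ℂ) * Complex.exp (incr (p ω) (a N) j * I) with hΦ
    have hem : StronglyMeasurable[urnFilt m R N] e := stronglyMeasurable_exp_rowSum a N
    have hen : ∀ ω, ‖e ω‖ = 1 := fun ω => Complex.norm_exp_ofReal_mul_I _
    have hei : Integrable e μ := .of_bound (hem.mono (hR.filt_le N)).aestronglyMeasurable 1
      (ae_of_all _ fun ω => (hen ω).le)
    have hcm : ∀ j, StronglyMeasurable[urnFilt m R N]
        fun ω => Complex.exp (incr (p ω) (a N) j * I) := fun j =>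
      Continuous.comp_stronglyMeasurable (g := fun x : ℝ => Complex.exp (x * I)) (by fun_prop)
        (stronglyMeasurable_comp le_rfl (continuous_incr _ _ j).stronglyMeasurable)
    have hm1 : ∀ j, StronglyMeasurable[urnFilt m R N]
        (fun ω => e ω * Complex.exp (incr (p ω) (a N) j * I)) := fun j => hem.mul (hcm j)
    have step := hR.integral_step N (X := fun ω => Complex.exp (rowSum m R a (N + 1) ω * I))
      (h := fun j ω => e ω * Complex.exp (incr (p ω) (a N) j * I)) hm1
      (fun j => .of_bound ((hm1 j).mono (hR.filt_le N)).aestronglyMeasurable 1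
        (ae_of_all _ fun ω => by rw [norm_mul, hen, Complex.norm_exp_ofReal_mul_I, one_mul]))
      (ae_of_all _ fun ω j h => by
        simp only [he, hp]
        rw [rowSum, Finset.sum_range_succ, rowIncr_of_eq_addBall _ h, ← Complex.exp_add, ← rowSum]
        rw [Complex.ofReal_add, add_mul])
    have step' : ∫ ω, Complex.exp (rowSum m R a (N + 1) ω * I) ∂μ = ∫ ω, e ω * Φ ω ∂μ := by
      rw [step]
      refine integral_congr_ae (ae_of_all _ fun ω => ?_)
      simp only [hΦ, Finset.mul_sum]
      exact Finset.sum_congr rfl fun j _ => by ring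
    have hΦm : StronglyMeasurable Φ := by
      refine Finset.stronglyMeasurable_fun_sum _ fun j _ => ?_
      refine StronglyMeasurable.mul ?_ ((hcm j).mono (hR.filt_le N))
      exact (stronglyMeasurable_comp (R := R) (f := fun w : Fin m → ℝ => ((w j / (N + 1) : ℝ) : ℂ))
        le_rfl (by fun_prop : Continuous _).stronglyMeasurable).mono (hR.filt_le N)
    set δ : Ω → ℝ := fun ω => ∑ q ∈ (Finset.range (2 * m)).filter (fun q => ¬ m ∣ q),
      ‖ucoef m q (R N ω)‖ / (N + 1) with hδ
    have hp0 : ∀ ω j, 0 ≤ p ω j := fun ω j => div_nonneg (hR.nonneg N ω j) (by positivity)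
    have hps : ∀ᵐ ω ∂μ, ∑ j, p ω j = 1 := by
      filter_upwards [hR.ae_sum_eq N] with ω h
      simp only [hp]
      rw [← Finset.sum_div, h, div_self (by positivity)]
    have hbound : ∀ᵐ ω ∂μ, ‖Φ ω - (Real.exp (-limVar m (a N) / 2) : ℂ)‖ ≤ A ^ 2 * (δ ω + 2 * A) := by
      filter_upwards [hps] with ω h
      refine norm_sum_mul_exp_incr_sub_le hm h2 (hp0 ω) h (a N) (ha N) fun q hq hmq => ?_
      have e1 : fourierMean (p ω) q = cw m ^ q * (ucoef m q (R N ω) / ((N + 1 : ℝ) : ℂ)) :=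
        sum_mul_cw_pow q (R N ω) (N + 1)
      rw [e1, norm_mul, norm_cw_pow, one_mul, norm_div, Complex.norm_real,
        Real.norm_of_nonneg (by positivity)]
      exact Finset.single_le_sum (f := fun q => ‖ucoef m q (R N ω)‖ / ((N : ℝ) + 1))
        (fun _ _ => by positivity) (Finset.mem_filter.2 ⟨Finset.mem_range.2 hq, hmq⟩)
    have hδi : Integrable δ μ :=
      integrable_finsetSum _ fun q _ => (hR.integrable_ucoef N q).norm.div_const _
    have hδint : ∫ ω, δ ω ∂μ = mixErr μ m R N :=
      integral_finsetSum _ fun q _ => (hR.integrable_ucoef N q).norm.div_const _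
    have hBi : Integrable (fun ω => A ^ 2 * (δ ω + 2 * A)) μ :=
      (hδi.add (integrable_const _)).const_mul _
    have hdi : Integrable (fun ω => e ω * (Φ ω - (Real.exp (-limVar m (a N) / 2) : ℂ))) μ := by
      refine hBi.mono' ((hem.mono (hR.filt_le N)).mul
        (hΦm.sub stronglyMeasurable_const)).aestronglyMeasurable ?_
      filter_upwards [hbound] with ω h
      rwa [norm_mul, hen, one_mul]
    have hmain : ‖∫ ω, e ω * (Φ ω - (Real.exp (-limVar m (a N) / 2) : ℂ)) ∂μ‖ ≤
        A ^ 2 * (mixErr μ m R N + 2 * A) := by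
      refine (norm_integral_le_of_norm_le hBi ?_).trans (le_of_eq ?_)
      · filter_upwards [hbound] with ω h
        rwa [norm_mul, hen, one_mul]
      · rw [integral_const_mul, integral_add hδi (integrable_const _), hδint]
        simp
    have hsplit : ∫ ω, e ω * Φ ω ∂μ = ∫ ω, e ω * (Φ ω - (Real.exp (-limVar m (a N) / 2) : ℂ)) ∂μ +
        (∫ ω, e ω ∂μ) * (Real.exp (-limVar m (a N) / 2) : ℂ) := by
      rw [← integral_mul_const, ← integral_add hdi (hei.mul_const _)]
      exact integral_congr_ae (ae_of_all _ fun ω => by ring)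
    have hE : ‖(Real.exp (-limVar m (a N) / 2) : ℂ)‖ ≤ 1 := by
      rw [Complex.norm_real, Real.norm_of_nonneg (Real.exp_nonneg _), Real.exp_le_one_iff]
      linarith [limVar_nonneg hm (a N)]
    have hexp : (Real.exp (-(L + limVar m (a N)) / 2) : ℂ) =
        (Real.exp (-L / 2) : ℂ) * (Real.exp (-limVar m (a N) / 2) : ℂ) := by
      rw [← Complex.ofReal_mul, ← Real.exp_add]
      ring_nf
    rw [step', hsplit, Finset.sum_range_succ, Finset.sum_range_succ, hexp, add_sub_assoc, ← sub_mul,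
      add_comm]
    refine (norm_add_le _ _).trans (add_le_add ?_ hmain)
    rw [norm_mul]
    exact (mul_le_of_le_one_right (norm_nonneg _) hE).trans ih

end IsCyclicUrn

/-- Weighted sums of a null sequence are small when the weights are uniformly small. -/
lemma eventually_sum_sq_mul_le {w : ℕ → ℕ → ℝ} {η : ℕ → ℝ} {B : ℝ} (hw : ∀ n j, 0 ≤ w n j)
    (hη0 : ∀ j, 0 ≤ η j) (hη : Tendsto η atTop (𝓝 0))
    (hsup : ∀ ε > 0, ∀ᶠ n in atTop, ∀ j, w n j ≤ ε)
    (hB : ∀ᶠ n in atTop, ∀ N, ∑ j ∈ Finset.range N, w n j ^ 2 ≤ B) {ρ : ℝ} (hρ : 0 < ρ) :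
    ∀ᶠ n in atTop, ∀ N, ∑ j ∈ Finset.range N, w n j ^ 2 * (η j + 2 * w n j) ≤ ρ := by
  have hB0 : 0 ≤ B := by
    obtain ⟨n, hn⟩ := hB.exists
    simpa using hn 0
  obtain ⟨J, hJ⟩ := eventually_atTop.1 (hη.eventually_le_const
    (show 0 < ρ / (3 * (B + 1)) by positivity))
  set K := ∑ j ∈ Finset.range J, η j with hK
  have hK0 : 0 ≤ K := Finset.sum_nonneg fun j _ => hη0 j
  set ε := min 1 (min (ρ / (6 * (B + 1))) (ρ / (3 * (K + 1)))) with hε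
  have hε0 : 0 < ε := by positivity
  filter_upwards [hB, hsup ε hε0] with n hBn hs N
  have e1 : ε ≤ 1 := min_le_left _ _
  have e2 : ε * (6 * (B + 1)) ≤ ρ :=
    (le_div_iff₀ (by positivity)).1 ((min_le_right _ _).trans (min_le_left _ _))
  have e3 : ε * (3 * (K + 1)) ≤ ρ :=
    (le_div_iff₀ (by positivity)).1 ((min_le_right _ _).trans (min_le_right _ _))
  set ρ' := ρ / (3 * (B + 1)) with hρ'
  have e4 : ρ' * (3 * (B + 1)) = ρ := div_mul_cancel₀ _ (by positivity)
  have hρ'0 : 0 < ρ' := by positivity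
  have hterm : ∀ j, w n j ^ 2 * (η j + 2 * w n j) ≤
      w n j ^ 2 * (ρ' + 2 * ε) + ε * (if j < J then η j else 0) := by
    intro j
    have h0 := hw n j
    have h1 := hs j
    have h2 : w n j ^ 2 ≤ ε := by nlinarith
    have h3 : w n j ^ 2 * (2 * w n j) ≤ w n j ^ 2 * (2 * ε) := by gcongr
    split_ifs with h
    · have := mul_le_mul_of_nonneg_right h2 (hη0 j)
      have : 0 ≤ w n j ^ 2 * ρ' := by positivity
      linarith
    · have := mul_le_mul_of_nonneg_left (hJ j (not_lt.1 h)) (sq_nonneg (w n j))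
      linarith
  have hKs : ∑ j ∈ Finset.range N, (if j < J then η j else 0) ≤ K := by
    rw [← Finset.sum_filter]
    refine Finset.sum_le_sum_of_subset_of_nonneg (fun j hj => ?_) fun j _ _ => hη0 j
    exact Finset.mem_range.2 (Finset.mem_filter.1 hj).2
  calc _ ≤ ∑ j ∈ Finset.range N, (w n j ^ 2 * (ρ' + 2 * ε) + ε * (if j < J then η j else 0)) :=
        Finset.sum_le_sum fun j _ => hterm j
    _ = (∑ j ∈ Finset.range N, w n j ^ 2) * (ρ' + 2 * ε) +
        ε * ∑ j ∈ Finset.range N, (if j < J then η j else 0) := by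
      rw [Finset.sum_add_distrib, ← Finset.sum_mul, ← Finset.mul_sum]
    _ ≤ B * (ρ' + 2 * ε) + ε * K := by
      have := hBn N
      gcongr
    _ ≤ ρ := by nlinarith

namespace IsCyclicUrn

variable {Ω : Type*} [mΩ : MeasurableSpace Ω] {μ : Measure Ω} {m : ℕ} {j0 : Fin m}
  {R : ℕ → Ω → Fin m → ℝ}

/-- Central limit theorem for an array of martingale increments, in terms of characteristic
functions. -/
lemma tendsto_integral_exp_of_rows (hm : 2 ≤ m) (h2 : 2 ∣ m) (hR : IsCyclicUrn μ m j0 R)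
    {a : ℕ → ℕ → ℕ → ℂ} {Y : ℕ → Ω → ℝ} {B V : ℝ} {L : ℕ → ℝ}
    (hY : ∀ᶠ n in atTop, ∀ᵐ ω ∂μ, Tendsto (fun N => rowSum m R (a n) N ω) atTop (𝓝 (Y n ω)))
    (hsup : ∀ ε > 0, ∀ᶠ n in atTop, ∀ j, totalWeight m (a n j) ≤ ε)
    (hB : ∀ᶠ n in atTop, ∀ N, ∑ j ∈ Finset.range N, totalWeight m (a n j) ^ 2 ≤ B)
    (hL : ∀ᶠ n in atTop,
      Tendsto (fun N => ∑ j ∈ Finset.range N, limVar m (a n j)) atTop (𝓝 (L n)))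
    (hV : Tendsto L atTop (𝓝 V)) :
    Tendsto (fun n => ∫ ω, Complex.exp (Y n ω * I) ∂μ) atTop (𝓝 (Real.exp (-V / 2) : ℂ)) := by
  have := hR.isProb
  have hG : Tendsto (fun n => (Real.exp (-L n / 2) : ℂ)) atTop (𝓝 (Real.exp (-V / 2) : ℂ)) :=
    ((Complex.continuous_ofReal.comp (by fun_prop : Continuous fun x : ℝ =>
      Real.exp (-x / 2))).tendsto V).comp hV
  suffices h : Tendsto (fun n => ∫ ω, Complex.exp (Y n ω * I) ∂μ - (Real.exp (-L n / 2) : ℂ))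
      atTop (𝓝 0) by
    simpa using h.add hG
  rw [Metric.tendsto_nhds]
  intro ρ hρ
  filter_upwards [hY, hL, hsup (1 / 2) (by norm_num), eventually_sum_sq_mul_le
    (w := fun n j => totalWeight m (a n j)) (fun n j => totalWeight_nonneg m _)
    (mixErr_nonneg (μ := μ) (R := R)) hR.tendsto_mixErr hsup hB (half_pos hρ)] with n hYn hLn ha hE
  rw [dist_zero_right]
  refine lt_of_le_of_lt ?_ (half_lt_self hρ)
  have h1 : Tendsto (fun N => ∫ ω, Complex.exp (rowSum m R (a n) N ω * I) ∂μ) atTop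
      (𝓝 (∫ ω, Complex.exp (Y n ω * I) ∂μ)) := by
    refine tendsto_integral_of_dominated_convergence (fun _ => 1)
      (fun N => ((stronglyMeasurable_exp_rowSum (a n) N).mono (hR.filt_le N)).aestronglyMeasurable)
      (integrable_const _) (fun N => ae_of_all _ fun ω => ?_) ?_
    · rw [Complex.norm_exp_ofReal_mul_I]
    · filter_upwards [hYn] with ω h
      exact ((by fun_prop : Continuous fun x : ℝ => Complex.exp (x * I)).tendsto _).comp h
  have h2' : Tendsto (fun N => (Real.exp (-(∑ j ∈ Finset.range N, limVar m (a n j)) / 2) : ℂ)) atTop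
      (𝓝 (Real.exp (-L n / 2) : ℂ)) :=
    ((Complex.continuous_ofReal.comp (by fun_prop : Continuous fun x : ℝ =>
      Real.exp (-x / 2))).tendsto (L n)).comp hLn
  exact le_of_tendsto (h1.sub h2').norm (Eventually.of_forall fun N =>
    (hR.norm_integral_exp_rowSum_sub_le hm h2 (a n) ha N).trans (hE N))

end IsCyclicUrn

/-- The normalizing coefficient `Γ(n+1)/Γ(n+1+s)`. -/
def gam (s : ℂ) (n : ℕ) : ℂ := Complex.Gamma ((n : ℂ) + 1) / Complex.Gamma ((n : ℂ) + 1 + s)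

lemma gam_ne_zero {s : ℂ} (hs : -2 < s.re) {n : ℕ} (hn : 1 ≤ n) : gam s n ≠ 0 := by
  have : (1 : ℝ) ≤ n := by exact_mod_cast hn
  refine div_ne_zero (Complex.Gamma_ne_zero_of_re_pos ?_) (Complex.Gamma_ne_zero_of_re_pos ?_)
  · simp; linarith
  · simp; linarith

lemma gam_succ_mul {s : ℂ} (hs : -2 < s.re) {n : ℕ} (hn : 1 ≤ n) :
    gam s (n + 1) * (1 + s / (n + 1)) = gam s n := by
  have h1 : (1 : ℝ) ≤ n := by exact_mod_cast hn
  have hn1 : (n : ℂ) + 1 ≠ 0 := Nat.cast_add_one_ne_zero n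
  have hns : (n : ℂ) + 1 + s ≠ 0 := fun h => by
    have := congrArg Complex.re h
    simp at this
    linarith
  have hG : Complex.Gamma ((n : ℂ) + 1 + s) ≠ 0 :=
    Complex.Gamma_ne_zero_of_re_pos (by simp; linarith)
  rw [gam, gam]
  push_cast
  rw [show (n : ℂ) + 1 + 1 + s = (n + 1 + s) + 1 by ring, Complex.Gamma_add_one _ hn1,
    Complex.Gamma_add_one _ hns]
  field_simp

lemma Gamma_add_two_add_natCast {s : ℂ} (hs : -2 < s.re) (n : ℕ) :
    Complex.Gamma (s + 2 + n) =
      (∏ j ∈ Finset.range n, (s + 2 + j)) * Complex.Gamma (s + 2) := by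
  induction n with
  | zero => simp
  | succ n ih =>
    have : s + 2 + n ≠ 0 := fun h => by
      have := congrArg Complex.re h
      simp at this
      have : (0 : ℝ) ≤ n := by positivity
      linarith
    push_cast
    rw [← add_assoc, Complex.Gamma_add_one _ this, ih, Finset.prod_range_succ]
    ring

lemma tendsto_gam_mul_cpow {s : ℂ} (hs : -2 < s.re) :
    Tendsto (fun n : ℕ => gam s n * (n : ℂ) ^ s) atTop (𝓝 1) := by
  have hG2 : Complex.Gamma (s + 2) ≠ 0 := Complex.Gamma_ne_zero_of_re_pos (by simp; linarith)
  have h1 := (Complex.GammaSeq_tendsto_Gamma (s + 2)).div_const (Complex.Gamma (s + 2))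
  rw [div_self hG2] at h1
  have hinv : Tendsto (fun n : ℕ => ((n : ℂ))⁻¹) atTop (𝓝 0) := tendsto_inv_atTop_nhds_zero_nat
  have hf : ∀ c : ℂ, Tendsto (fun n : ℕ => 1 + c * ((n : ℂ))⁻¹) atTop (𝓝 1) := fun c => by
    simpa using (hinv.const_mul c).const_add 1
  have h2 := (h1.mul (hf (2 + s))).mul (hf (1 + s))
  rw [one_mul, one_mul] at h2
  refine h2.congr' ?_
  filter_upwards [eventually_ge_atTop 1] with n hn
  have hnR : (1 : ℝ) ≤ n := by exact_mod_cast hn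
  have hn0 : (n : ℂ) ≠ 0 := by
    have : n ≠ 0 := by omega
    exact_mod_cast this
  have hns1 : (n : ℂ) + 1 + s ≠ 0 := fun h => by
    have := congrArg Complex.re h
    simp at this
    linarith
  have hns2 : (n : ℂ) + 1 + s + 1 ≠ 0 := fun h => by
    have := congrArg Complex.re h
    simp at this
    linarith
  have hG : Complex.Gamma ((n : ℂ) + 1 + s) ≠ 0 :=
    Complex.Gamma_ne_zero_of_re_pos (by simp; linarith)
  have e1 := Gamma_add_two_add_natCast hs (n + 1)
  have e2 : s + 2 + ((n + 1 : ℕ) : ℂ) = (n + 1 + s + 1) + 1 := by push_cast; ring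
  rw [e2, Complex.Gamma_add_one _ hns2, Complex.Gamma_add_one _ hns1] at e1
  have hP : ∏ j ∈ Finset.range (n + 1), (s + 2 + j) ≠ 0 := by
    intro h
    rw [h, zero_mul] at e1
    exact mul_ne_zero hns2 (mul_ne_zero hns1 hG) e1
  rw [Complex.GammaSeq, gam, Complex.Gamma_nat_eq_factorial, Complex.cpow_add _ _ hn0, div_div, ← e1]
  rw [show (n : ℂ) ^ (2 : ℂ) = (n : ℂ) ^ 2 by norm_cast]
  field_simp
  ring

lemma norm_natCast_cpow {s : ℂ} {n : ℕ} (hn : 1 ≤ n) : ‖(n : ℂ) ^ s‖ = (n : ℝ) ^ s.re := by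
  rw [Complex.norm_natCast_cpow_of_pos (by omega)]

lemma tendsto_norm_gam_mul_rpow {s : ℂ} (hs : -2 < s.re) :
    Tendsto (fun n : ℕ => ‖gam s n‖ * (n : ℝ) ^ s.re) atTop (𝓝 1) := by
  have h := (tendsto_gam_mul_cpow hs).norm
  rw [norm_one] at h
  refine h.congr' ?_
  filter_upwards [eventually_ge_atTop 1] with n hn
  rw [norm_mul, norm_natCast_cpow hn]

lemma tendsto_norm_gam_sq_mul_rpow {s : ℂ} (hs : -2 < s.re) :
    Tendsto (fun n : ℕ => ‖gam s n‖ ^ 2 * (n : ℝ) ^ (2 * s.re)) atTop (𝓝 1) := by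
  have h := (tendsto_norm_gam_mul_rpow hs).pow 2
  rw [one_pow] at h
  refine h.congr fun n => ?_
  rw [mul_pow, mul_comm 2 s.re, Real.rpow_mul (by positivity)]
  norm_cast

lemma norm_gam_sq_eq {s : ℂ} (hs : -2 < s.re) (h1 : ‖s‖ = 1) {n : ℕ} (hn : 1 ≤ n) :
    ‖gam s n‖ ^ 2 =
      ‖gam s (n + 1)‖ ^ 2 * (1 + 2 * s.re / (n + 1) + 1 / ((n : ℝ) + 1) ^ 2) := by
  rw [← gam_succ_mul hs hn, norm_mul, mul_pow]
  congr 1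
  have h2 : s.re ^ 2 + s.im ^ 2 = 1 := by
    have := Complex.sq_norm s
    rw [h1, Complex.normSq_apply] at this
    linarith
  have : (1 + s / ((n : ℂ) + 1)) = ((1 + s.re / (n + 1) : ℝ) : ℂ) + ((s.im / (n + 1) : ℝ) : ℂ) * I := by
    conv_lhs => rw [← Complex.re_add_im s]
    push_cast
    ring
  rw [this, Complex.sq_norm, Complex.normSq_add_mul_I]
  have : (n : ℝ) + 1 ≠ 0 := by positivity
  field_simp
  nlinarith

/-- A Stolz–Cesàro theorem for diverging sums. -/
lemma tendsto_div_sum_of_isLittleO {d T : ℕ → ℝ} {a : ℝ} (hd : ∀ n, 0 ≤ d n)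
    (hD : Tendsto (fun n => ∑ j ∈ Finset.range n, d j) atTop atTop)
    (h : (fun n => T (n + 1) - T n - a * d n) =o[atTop] d) :
    Tendsto (fun n => T n / ∑ j ∈ Finset.range n, d j) atTop (𝓝 a) := by
  have h1 := (h.sum_range hd hD).tendsto_div_nhds_zero
  have h2 : Tendsto (fun n => T 0 / ∑ j ∈ Finset.range n, d j) atTop (𝓝 0) :=
    tendsto_const_nhds.div_atTop hD
  have h3 := (h1.add h2).add_const a
  rw [add_zero, zero_add] at h3
  refine h3.congr' ?_
  filter_upwards [hD.eventually_gt_atTop 0] with n hn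
  rw [Finset.sum_sub_distrib, Finset.sum_range_sub, ← Finset.mul_sum]
  field_simp
  ring

/-- A Stolz–Cesàro theorem for tails of convergent sums. -/
lemma tendsto_div_tsum_of_isLittleO {d T : ℕ → ℝ} {a : ℝ} (hd : ∀ n, 0 < d n) (hs : Summable d)
    (hT : Tendsto T atTop (𝓝 0)) (h : (fun n => T (n + 1) - T n - a * d n) =o[atTop] d) :
    Tendsto (fun n => T n / ∑' j, d (j + n)) atTop (𝓝 (-a)) := by
  rw [Metric.tendsto_atTop]
  intro ε hε
  obtain ⟨J, hJ⟩ := eventually_atTop.1 (h.bound (half_pos hε))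
  refine ⟨J, fun n hn => ?_⟩
  have hsn : Summable fun j => d (j + n) := (summable_nat_add_iff n).2 hs
  set D := ∑' j, d (j + n) with hD
  have hDpos : 0 < D := hsn.tsum_pos (fun j => (hd _).le) 0 (hd _)
  have h1 : ∀ N, |T (N + n) - T n - a * ∑ j ∈ Finset.range N, d (j + n)| ≤ ε / 2 * D := by
    intro N
    have e : T (N + n) - T n - a * ∑ j ∈ Finset.range N, d (j + n) =
        ∑ j ∈ Finset.range N, (T (j + n + 1) - T (j + n) - a * d (j + n)) := by
      have := Finset.sum_range_sub (fun j => T (j + n)) N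
      simp only [zero_add, add_right_comm _ 1 n] at this
      rw [Finset.sum_sub_distrib, this, ← Finset.mul_sum]
    rw [e]
    calc _ ≤ ∑ j ∈ Finset.range N, ε / 2 * d (j + n) := by
          refine (Finset.abs_sum_le_sum_abs _ _).trans (Finset.sum_le_sum fun j _ => ?_)
          have := hJ (j + n) (by omega)
          rwa [Real.norm_eq_abs, Real.norm_of_nonneg (hd _).le] at this
      _ ≤ _ := by
          rw [← Finset.mul_sum]
          have := hsn.sum_le_tsum (Finset.range N) fun j _ => (hd _).le
          gcongr
  have h2 : Tendsto (fun N => |T (N + n) - T n - a * ∑ j ∈ Finset.range N, d (j + n)|) atTop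
      (𝓝 |0 - T n - a * D|) :=
    ((((tendsto_add_atTop_iff_nat n).2 hT).sub_const _).sub
      (hsn.hasSum.tendsto_sum_nat.const_mul a)).abs
  have h3 := le_of_tendsto h2 (Eventually.of_forall h1)
  rw [Real.dist_eq, sub_neg_eq_add]
  have e : T n / D + a = -(0 - T n - a * D) / D := by field_simp; ring
  rw [e, abs_div, abs_neg, abs_of_pos hDpos, div_lt_iff₀ hDpos]
  nlinarith

lemma eventually_forall_lt_le_mul_sum {d : ℕ → ℝ} (hd : ∀ n, 0 ≤ d n)
    (hD : Tendsto (fun n => ∑ j ∈ Finset.range n, d j) atTop atTop)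
    (h : d =o[atTop] fun n => ∑ j ∈ Finset.range (n + 1), d j) {ε : ℝ} (hε : 0 < ε) :
    ∀ᶠ n in atTop, ∀ j < n, d j ≤ ε * ∑ i ∈ Finset.range n, d i := by
  obtain ⟨J, hJ⟩ := eventually_atTop.1 (h.bound hε)
  filter_upwards [hD.eventually_ge_atTop ((∑ i ∈ Finset.range J, d i) / ε)] with n hn j hj
  rcases lt_or_ge j J with hjJ | hjJ
  · rw [div_le_iff₀ hε] at hn
    have := Finset.single_le_sum (f := d) (fun i _ => hd i) (Finset.mem_range.2 hjJ)
    linarith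
  · have h1 := hJ j hjJ
    have h0 : 0 ≤ ∑ i ∈ Finset.range (j + 1), d i := Finset.sum_nonneg fun i _ => hd i
    rw [Real.norm_of_nonneg (hd j), Real.norm_of_nonneg h0] at h1
    refine h1.trans (mul_le_mul_of_nonneg_left ?_ hε.le)
    exact Finset.sum_le_sum_of_subset_of_nonneg (Finset.range_subset_range.2 hj)
      fun i _ _ => hd i

lemma eventually_forall_le_le_mul_tsum {d : ℕ → ℝ} (hd : ∀ n, 0 ≤ d n) (hs : Summable d)
    (h : d =o[atTop] fun n => ∑' j, d (j + n)) {ε : ℝ} (hε : 0 < ε) :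
    ∀ᶠ n in atTop, ∀ j ≥ n, d j ≤ ε * ∑' i, d (i + n) := by
  obtain ⟨J, hJ⟩ := eventually_atTop.1 (h.bound hε)
  filter_upwards [eventually_ge_atTop J] with n hn j hj
  have h1 := hJ j (hn.trans hj)
  have h0 : 0 ≤ ∑' i, d (i + j) := tsum_nonneg fun i => hd _
  rw [Real.norm_of_nonneg (hd j), Real.norm_of_nonneg h0] at h1
  refine h1.trans (mul_le_mul_of_nonneg_left ?_ hε.le)
  obtain ⟨c, rfl⟩ := Nat.exists_eq_add_of_le hj
  have hsn : Summable fun i => d (i + n) := (summable_nat_add_iff n).2 hs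
  have := hsn.sum_add_tsum_nat_add c
  have h2 : 0 ≤ ∑ i ∈ Finset.range c, d (i + n) := Finset.sum_nonneg fun i _ => hd _
  simp only [add_assoc] at this
  rw [add_comm n c]
  linarith

section Gam

variable {s : ℂ}

lemma norm_gam_sq_pos (hs : -2 < s.re) {n : ℕ} (hn : 1 ≤ n) : 0 < ‖gam s n‖ ^ 2 := by
  have := norm_pos_iff.2 (gam_ne_zero hs hn)
  positivity

lemma isLittleO_gam_diff (hs : -2 < s.re) (h1 : ‖s‖ = 1) :
    (fun n : ℕ => ((n + 1 : ℕ) : ℝ) * ‖gam s (n + 1)‖ ^ 2 - n * ‖gam s n‖ ^ 2 -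
      (1 - 2 * s.re) * ‖gam s (n + 1)‖ ^ 2) =o[atTop] fun n => ‖gam s (n + 1)‖ ^ 2 := by
  have hε : Tendsto (fun n : ℕ => (2 * s.re - 1) * (1 / ((n : ℝ) + 1)) +
      (1 / ((n : ℝ) + 1)) * (1 / ((n : ℝ) + 1))) atTop (𝓝 0) := by
    have := tendsto_one_div_add_atTop_nhds_zero_nat (𝕜 := ℝ)
    simpa using (this.const_mul (2 * s.re - 1)).add (this.mul this)
  refine Asymptotics.IsLittleO.congr' (f₁ := fun n : ℕ => ((2 * s.re - 1) * (1 / ((n : ℝ) + 1)) +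
      (1 / ((n : ℝ) + 1)) * (1 / ((n : ℝ) + 1))) * ‖gam s (n + 1)‖ ^ 2)
    (g₁ := fun n => 1 * ‖gam s (n + 1)‖ ^ 2)
    (((Asymptotics.isLittleO_one_iff ℝ).2 hε).mul_isBigO (Asymptotics.isBigO_refl _ _)) ?_ ?_
  · filter_upwards [eventually_ge_atTop 1] with n hn
    rw [norm_gam_sq_eq hs h1 hn]
    have : (n : ℝ) + 1 ≠ 0 := by positivity
    push_cast
    field_simp
    ring
  · exact Eventually.of_forall fun n => one_mul _

lemma isLittleO_gam_mul (s : ℂ) :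
    (fun n : ℕ => ‖gam s (n + 1)‖ ^ 2) =o[atTop]
      fun n => ((n + 1 : ℕ) : ℝ) * ‖gam s (n + 1)‖ ^ 2 := by
  have : (fun _ : ℕ => (1 : ℝ)) =o[atTop] fun n : ℕ => ((n + 1 : ℕ) : ℝ) := by
    rw [Asymptotics.isLittleO_one_left_iff]
    exact (tendsto_natCast_atTop_atTop.comp (tendsto_add_atTop_nat 1)).congr fun n =>
      (Real.norm_of_nonneg (Nat.cast_nonneg _)).symm
  simpa using this.mul_isBigO (Asymptotics.isBigO_refl (fun n : ℕ => ‖gam s (n + 1)‖ ^ 2) atTop)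

lemma tendsto_sum_norm_gam_sq (hs : -2 < s.re) (h : s.re ≤ 1 / 2) :
    Tendsto (fun n => ∑ j ∈ Finset.range n, ‖gam s (j + 1)‖ ^ 2) atTop atTop := by
  rw [← not_summable_iff_tendsto_nat_atTop_of_nonneg fun _ => by positivity]
  rw [summable_nat_add_iff (f := fun n => ‖gam s n‖ ^ 2) 1]
  intro hsum
  refine Real.not_summable_natCast_inv (summable_of_isBigO_nat hsum ?_)
  refine Asymptotics.IsBigO.of_bound 2 ?_
  filter_upwards [(tendsto_norm_gam_sq_mul_rpow hs).eventually_const_le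
    (show (1 / 2 : ℝ) < 1 by norm_num), eventually_ge_atTop 1] with n h1 hn
  have hn1 : (1 : ℝ) ≤ n := by exact_mod_cast hn
  rw [Real.norm_of_nonneg (by positivity), Real.norm_of_nonneg (by positivity),
    inv_le_iff_one_le_mul₀ (by linarith)]
  have h2 : (n : ℝ) ^ (2 * s.re) ≤ n := by
    calc (n : ℝ) ^ (2 * s.re) ≤ (n : ℝ) ^ (1 : ℝ) :=
          Real.rpow_le_rpow_of_exponent_le hn1 (by linarith)
      _ = n := Real.rpow_one _
  have := mul_le_mul_of_nonneg_left h2 (sq_nonneg ‖gam s n‖)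
  linarith

lemma summable_norm_gam_sq (hs : 1 / 2 < s.re) : Summable fun n => ‖gam s (n + 1)‖ ^ 2 := by
  rw [summable_nat_add_iff (f := fun n => ‖gam s n‖ ^ 2) 1]
  refine summable_of_isBigO_nat (Real.summable_nat_rpow (p := -(2 * s.re)).2 (by linarith)) ?_
  refine Asymptotics.IsBigO.of_bound 2 ?_
  filter_upwards [(tendsto_norm_gam_sq_mul_rpow (s := s) (by linarith)).eventually_le_const
    (show (1 : ℝ) < 2 by norm_num), eventually_ge_atTop 1] with n h1 hn
  have hn1 : (0 : ℝ) < n := by exact_mod_cast hn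
  rw [Real.norm_of_nonneg (by positivity), Real.norm_of_nonneg (by positivity),
    Real.rpow_neg hn1.le, ← div_eq_mul_inv, le_div_iff₀ (by positivity)]
  exact h1

lemma tendsto_mul_norm_gam_sq_zero (hs : 1 / 2 < s.re) :
    Tendsto (fun n : ℕ => (n : ℝ) * ‖gam s n‖ ^ 2) atTop (𝓝 0) := by
  have h1 := (tendsto_rpow_neg_atTop (show 0 < 2 * s.re - 1 by linarith)).comp
    (tendsto_natCast_atTop_atTop (R := ℝ))
  have h2 := (tendsto_norm_gam_sq_mul_rpow (s := s) (by linarith)).mul h1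
  rw [mul_zero] at h2
  refine h2.congr' ?_
  filter_upwards [eventually_ge_atTop 1] with n hn
  have hn1 : (0 : ℝ) < n := by exact_mod_cast hn
  simp only [Function.comp]
  rw [mul_assoc, ← Real.rpow_add hn1, mul_comm]
  congr 1
  rw [show 2 * s.re + -(2 * s.re - 1) = 1 by ring, Real.rpow_one]

end Gam

/-- Arrays of weights which are uniformly null and have a limiting sum of squares `v`. -/
structure IsNullArray (w : ℕ → ℕ → ℂ) (v : ℝ) : Prop where
  eventually_norm_le : ∀ ε > 0, ∀ᶠ n in atTop, ∀ j, ‖w n j‖ ≤ ε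
  exists_hasSum : ∃ L : ℕ → ℝ, (∀ᶠ n in atTop, HasSum (fun j => ‖w n j‖ ^ 2) (L n)) ∧
    Tendsto L atTop (𝓝 v)

lemma isNullArray_of_sq_le {w : ℕ → ℕ → ℂ} {v : ℝ} {L : ℕ → ℝ}
    (hL : ∀ᶠ n in atTop, HasSum (fun j => ‖w n j‖ ^ 2) (L n)) (hv : Tendsto L atTop (𝓝 v))
    (hmax : ∀ ε > 0, ∀ᶠ n in atTop, ∀ j, ‖w n j‖ ^ 2 ≤ ε * L n) : IsNullArray w v := by
  refine ⟨fun ε hε => ?_, L, hL, hv⟩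
  filter_upwards [hmax (ε ^ 2 / (|v| + 1)) (by positivity),
    hv.eventually_le_const (show v < |v| + 1 by linarith [le_abs_self v])] with n h1 h2 j
  refine le_of_sq_le_sq ?_ hε.le
  calc ‖w n j‖ ^ 2 ≤ ε ^ 2 / (|v| + 1) * L n := h1 j
    _ ≤ ε ^ 2 / (|v| + 1) * (|v| + 1) := by gcongr
    _ = ε ^ 2 := by field_simp

section Gam

variable {s : ℂ}

/-- The weights of the martingale increments up to time `n`, with normalization `σ n`. -/
def headWeight (s : ℂ) (σ : ℕ → ℝ) (n j : ℕ) : ℂ :=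
  if j < n then (σ n : ℂ)⁻¹ * (gam s n)⁻¹ * gam s (j + 1) else 0

/-- The weights of the martingale increments after time `n`, with normalization `σ n`. -/
def tailWeight (s : ℂ) (σ : ℕ → ℝ) (n j : ℕ) : ℂ :=
  if n ≤ j then -((σ n : ℂ)⁻¹ * (gam s n)⁻¹ * gam s (j + 1)) else 0

lemma norm_headWeight_sq (s : ℂ) (σ : ℕ → ℝ) (n j : ℕ) :
    ‖headWeight s σ n j‖ ^ 2 =
      if j < n then ‖gam s (j + 1)‖ ^ 2 / (σ n ^ 2 * ‖gam s n‖ ^ 2) else 0 := by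
  unfold headWeight
  split_ifs
  · rw [norm_mul, norm_mul, norm_inv, norm_inv, Complex.norm_real, Real.norm_eq_abs, mul_pow,
      mul_pow, inv_pow, inv_pow, sq_abs]
    field_simp
  · simp

lemma norm_tailWeight_sq (s : ℂ) (σ : ℕ → ℝ) (n j : ℕ) :
    ‖tailWeight s σ n j‖ ^ 2 =
      if n ≤ j then ‖gam s (j + 1)‖ ^ 2 / (σ n ^ 2 * ‖gam s n‖ ^ 2) else 0 := by
  unfold tailWeight
  split_ifs
  · rw [norm_neg, norm_mul, norm_mul, norm_inv, norm_inv, Complex.norm_real, Real.norm_eq_abs,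
      mul_pow, mul_pow, inv_pow, inv_pow, sq_abs]
    field_simp
  · simp

lemma isNullArray_headWeight_of_tendsto {σ : ℕ → ℝ} {v : ℝ}
    (hD : Tendsto (fun n => ∑ j ∈ Finset.range n, ‖gam s (j + 1)‖ ^ 2) atTop atTop)
    (ho : (fun n => ‖gam s (n + 1)‖ ^ 2) =o[atTop]
      fun n => ∑ j ∈ Finset.range (n + 1), ‖gam s (j + 1)‖ ^ 2)
    (hv : Tendsto (fun n => (∑ j ∈ Finset.range n, ‖gam s (j + 1)‖ ^ 2) /
      (σ n ^ 2 * ‖gam s n‖ ^ 2)) atTop (𝓝 v)) :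
    IsNullArray (headWeight s σ) v := by
  refine isNullArray_of_sq_le (Eventually.of_forall fun n => ?_) hv fun ε hε => ?_
  · have h : HasSum (fun j => ‖headWeight s σ n j‖ ^ 2)
        (∑ j ∈ Finset.range n, ‖headWeight s σ n j‖ ^ 2) :=
      hasSum_sum_of_ne_finset_zero fun j hj => by
        rw [norm_headWeight_sq, if_neg (by simpa using hj)]
    have e : ∑ j ∈ Finset.range n, ‖headWeight s σ n j‖ ^ 2 =
        (∑ j ∈ Finset.range n, ‖gam s (j + 1)‖ ^ 2) / (σ n ^ 2 * ‖gam s n‖ ^ 2) := by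
      rw [Finset.sum_div]
      refine Finset.sum_congr rfl fun j hj => ?_
      rw [norm_headWeight_sq, if_pos (Finset.mem_range.1 hj)]
    rwa [e] at h
  · filter_upwards [eventually_forall_lt_le_mul_sum (fun n => sq_nonneg ‖gam s (n + 1)‖) hD ho hε]
      with n h j
    rw [norm_headWeight_sq, ← mul_div_assoc]
    split_ifs with hj
    · exact div_le_div_of_nonneg_right (h j hj) (by positivity)
    · have : 0 ≤ ∑ j ∈ Finset.range n, ‖gam s (j + 1)‖ ^ 2 :=
        Finset.sum_nonneg fun _ _ => by positivity
      positivity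

lemma tendsto_mul_gam_div_sum (hs : -2 < s.re) (h1 : ‖s‖ = 1) (h : s.re ≤ 1 / 2) :
    Tendsto (fun n : ℕ => (n * ‖gam s n‖ ^ 2) / ∑ j ∈ Finset.range n, ‖gam s (j + 1)‖ ^ 2) atTop
      (𝓝 (1 - 2 * s.re)) :=
  tendsto_div_sum_of_isLittleO (T := fun n : ℕ => n * ‖gam s n‖ ^ 2)
    (fun n => sq_nonneg ‖gam s (n + 1)‖) (tendsto_sum_norm_gam_sq hs h) (isLittleO_gam_diff hs h1)

lemma isLittleO_gam_sum (hs : -2 < s.re) (h1 : ‖s‖ = 1) (h : s.re ≤ 1 / 2) :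
    (fun n => ‖gam s (n + 1)‖ ^ 2) =o[atTop]
      fun n => ∑ j ∈ Finset.range (n + 1), ‖gam s (j + 1)‖ ^ 2 := by
  refine (isLittleO_gam_mul s).trans_isBigO ?_
  refine Asymptotics.isBigO_of_div_tendsto_nhds (Eventually.of_forall fun n hn => ?_)
    (1 - 2 * s.re) ((tendsto_mul_gam_div_sum hs h1 h).comp (tendsto_add_atTop_nat 1))
  have h0 := Finset.single_le_sum (f := fun j => ‖gam s (j + 1)‖ ^ 2)
    (fun j _ => sq_nonneg _) (Finset.self_mem_range_succ n)
  rw [hn] at h0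
  exact absurd h0 (not_le.2 (norm_gam_sq_pos hs (by omega)))

lemma isNullArray_headWeight (hs : -2 < s.re) (h1 : ‖s‖ = 1) (h : s.re < 1 / 2) :
    IsNullArray (headWeight s fun n => √n) (1 - 2 * s.re)⁻¹ := by
  refine isNullArray_headWeight_of_tendsto (tendsto_sum_norm_gam_sq hs h.le)
    (isLittleO_gam_sum hs h1 h.le) ?_
  refine ((tendsto_mul_gam_div_sum hs h1 h.le).inv₀ (by linarith)).congr fun n => ?_
  rw [inv_div, Real.sq_sqrt (by positivity)]

lemma isNullArray_headWeight_critical (h1 : ‖s‖ = 1) (h : s.re = 1 / 2) :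
    IsNullArray (headWeight s fun n => √(n * Real.log n)) 1 := by
  have hs : -2 < s.re := by rw [h]; norm_num
  have hD := tendsto_sum_norm_gam_sq hs h.le
  refine isNullArray_headWeight_of_tendsto hD (isLittleO_gam_sum hs h1 h.le) ?_
  have hb : Tendsto (fun n : ℕ => (n : ℝ) * ‖gam s n‖ ^ 2) atTop (𝓝 1) := by
    refine (tendsto_norm_gam_sq_mul_rpow hs).congr fun n => ?_
    rw [h, mul_comm]
    norm_num
  have hb' : Tendsto (fun n : ℕ => ((n : ℝ) + 1) * ‖gam s (n + 1)‖ ^ 2) atTop (𝓝 1) :=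
    (hb.comp (tendsto_add_atTop_nat 1)).congr fun n => by simp
  have hlog : Tendsto (fun n : ℕ => ((n : ℝ) + 1) * (Real.log ((n + 1 : ℕ) : ℝ) - Real.log n))
      atTop (𝓝 1) := by
    have g1 : Tendsto (fun n : ℕ => (n : ℝ) * Real.log (1 + 1 / n)) atTop (𝓝 1) :=
      (Real.tendsto_mul_log_one_add_div_atTop 1).comp tendsto_natCast_atTop_atTop
    have g2 : Tendsto (fun n : ℕ => 1 + ((n : ℝ))⁻¹) atTop (𝓝 1) := by
      simpa using (tendsto_inv_atTop_nhds_zero_nat (𝕜 := ℝ)).const_add 1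
    have g3 := g1.mul g2
    rw [one_mul] at g3
    refine g3.congr' ?_
    filter_upwards [eventually_ge_atTop 1] with n hn
    have hn0 : (0 : ℝ) < n := by exact_mod_cast hn
    rw [← Real.log_div (by positivity) hn0.ne']
    push_cast
    rw [show 1 + 1 / (n : ℝ) = (n + 1) / n by field_simp]
    field_simp
  have hT := tendsto_div_sum_of_isLittleO (T := fun n : ℕ => Real.log n) (a := 1)
    (fun n => sq_nonneg ‖gam s (n + 1)‖) hD (by
      refine Asymptotics.isLittleO_of_tendsto' (Eventually.of_forall fun n hn =>
        absurd hn (norm_gam_sq_pos hs (by omega)).ne') ?_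
      have := (hlog.div hb' one_ne_zero).sub_const 1
      rw [div_one, sub_self] at this
      refine this.congr fun n => ?_
      have h2 := (norm_gam_sq_pos hs (n := n + 1) (by omega)).ne'
      have h3 : (n : ℝ) + 1 ≠ 0 := by positivity
      simp only [Pi.div_apply]
      rw [mul_div_mul_left _ _ h3, one_mul, sub_div _ (‖gam s (n + 1)‖ ^ 2), div_self h2])
  have := (hb.mul hT).inv₀ (by norm_num)
  rw [mul_one, inv_one] at this
  refine this.congr' ?_
  filter_upwards [eventually_ge_atTop 1] with n hn
  have hn1 : (1 : ℝ) ≤ n := by exact_mod_cast hn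
  rw [Real.sq_sqrt (mul_nonneg (by positivity) (Real.log_nonneg hn1)), ← mul_div_assoc, inv_div]
  congr 1
  ring

lemma isNullArray_tailWeight (h1 : ‖s‖ = 1) (h : 1 / 2 < s.re) :
    IsNullArray (tailWeight s fun n => √n) (2 * s.re - 1)⁻¹ := by
  have hs : -2 < s.re := by linarith
  have hsum := summable_norm_gam_sq h
  have hd : ∀ n, 0 < ‖gam s (n + 1)‖ ^ 2 := fun n => norm_gam_sq_pos hs (by omega)
  have hT := tendsto_div_tsum_of_isLittleO (T := fun n : ℕ => n * ‖gam s n‖ ^ 2) hd hsum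
    (tendsto_mul_norm_gam_sq_zero h) (isLittleO_gam_diff hs h1)
  have hDpos : ∀ n, 0 < ∑' j, ‖gam s (j + n + 1)‖ ^ 2 := fun n =>
    ((summable_nat_add_iff n).2 hsum).tsum_pos (fun j => (hd _).le) 0 (hd _)
  have hanti : ∀ n, ∑' j, ‖gam s (j + (n + 1) + 1)‖ ^ 2 ≤ ∑' j, ‖gam s (j + n + 1)‖ ^ 2 := by
    intro n
    have := ((summable_nat_add_iff n).2 hsum).sum_add_tsum_nat_add 1
    simp only [Finset.sum_range_one, add_right_comm _ 1 n] at this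
    have := hd (0 + n)
    simp only [← add_assoc] at *
    linarith
  refine isNullArray_of_sq_le
    (L := fun n => (∑' j, ‖gam s (j + n + 1)‖ ^ 2) / (√n ^ 2 * ‖gam s n‖ ^ 2))
    (Eventually.of_forall fun n => ?_) ?_ fun ε hε => ?_
  · have h2 : HasSum (fun j => ‖gam s (j + n + 1)‖ ^ 2 / (√n ^ 2 * ‖gam s n‖ ^ 2)) _ :=
      ((summable_nat_add_iff n).2 hsum).hasSum.div_const _
    refine ((hasSum_nat_add_iff' n).1 ?_)
    rw [Finset.sum_eq_zero fun j hj => by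
      rw [norm_tailWeight_sq, if_neg (not_le.2 (Finset.mem_range.1 hj))], sub_zero]
    refine h2.congr_fun fun j => ?_
    rw [norm_tailWeight_sq, if_pos (by omega)]
  · have := hT.inv₀ (by linarith)
    rw [neg_sub] at this
    refine this.congr fun n => ?_
    rw [inv_div, Real.sq_sqrt (by positivity)]
  · have ho : (fun n => ‖gam s (n + 1)‖ ^ 2) =o[atTop] fun n => ∑' j, ‖gam s (j + n + 1)‖ ^ 2 := by
      refine (isLittleO_gam_mul s).trans_isBigO ?_
      refine Asymptotics.IsBigO.trans (g := fun n => ∑' j, ‖gam s (j + (n + 1) + 1)‖ ^ 2) ?_ ?_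
      · exact Asymptotics.isBigO_of_div_tendsto_nhds
          (Eventually.of_forall fun n hn => absurd hn (hDpos (n + 1)).ne') _
          (hT.comp (tendsto_add_atTop_nat 1))
      · refine Asymptotics.IsBigO.of_bound 1 (Eventually.of_forall fun n => ?_)
        rw [one_mul, Real.norm_of_nonneg (hDpos _).le, Real.norm_of_nonneg (hDpos _).le]
        exact hanti n
    filter_upwards [eventually_forall_le_le_mul_tsum (fun n => (hd n).le) hsum ho hε] with n h2 j
    rw [norm_tailWeight_sq, ← mul_div_assoc]
    split_ifs with hj
    · exact div_le_div_of_nonneg_right (h2 j hj) (by positivity)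
    · have := hDpos n
      positivity

end Gam

lemma isBigO_one_sub_mul_cpow (s : ℂ) :
    (fun t : ℂ => 1 - (1 + s * t) * (1 - t) ^ s) =O[𝓝 0] fun t => t ^ 2 := by
  set r : ℂ → ℂ := fun t => (1 - t) ^ s - (1 - s * t) with hr
  have hr2 : r =O[𝓝 0] fun t => t ^ 2 := by
    have hlog : (fun t : ℂ => Complex.log (1 - t) + t) =O[𝓝 0] fun t => t ^ 2 := by
      refine Asymptotics.IsBigO.of_bound 1 ?_
      filter_upwards [Metric.ball_mem_nhds (0 : ℂ) (show (0 : ℝ) < 1 / 2 by norm_num)] with t ht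
      rw [mem_ball_zero_iff] at ht
      have h := Complex.norm_log_one_add_sub_self_le (z := -t) (by rw [norm_neg]; linarith)
      rw [norm_neg, sub_neg_eq_add, ← sub_eq_add_neg] at h
      refine h.trans ?_
      rw [norm_pow, one_mul]
      have : (1 - ‖t‖)⁻¹ ≤ 2 := by
        rw [inv_le_comm₀ (by linarith) (by norm_num)]
        linarith
      nlinarith [sq_nonneg ‖t‖]
    have hlog1 : (fun t : ℂ => s * Complex.log (1 - t)) =O[𝓝 0] fun t => t := by
      have h1 : (fun t : ℂ => t ^ 2) =O[𝓝 0] fun t => t := by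
        simpa using (Asymptotics.isLittleO_pow_id (𝕜 := ℂ) one_lt_two).isBigO
      refine Asymptotics.IsBigO.const_mul_left ?_ s
      simpa using (hlog.trans h1).sub (Asymptotics.isBigO_refl (fun t : ℂ => t) (𝓝 0))
    have hexp : (fun z : ℂ => Complex.exp z - 1 - z) =O[𝓝 0] fun z => z ^ 2 := by
      refine Asymptotics.IsBigO.of_bound 1 ?_
      filter_upwards [Metric.ball_mem_nhds (0 : ℂ) one_pos] with t ht
      rw [mem_ball_zero_iff] at ht
      rw [norm_pow, one_mul]
      exact Complex.norm_exp_sub_one_sub_id_le ht.le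
    have ht : Tendsto (fun t : ℂ => s * Complex.log (1 - t)) (𝓝 0) (𝓝 0) :=
      hlog1.trans_tendsto tendsto_id
    have h1 := (hexp.comp_tendsto ht).trans (hlog1.pow 2)
    refine (h1.add (hlog.const_mul_left s)).congr' ?_ Filter.EventuallyEq.rfl
    filter_upwards [Metric.ball_mem_nhds (0 : ℂ) one_pos] with t ht
    rw [mem_ball_zero_iff] at ht
    have h0 : (1 : ℂ) - t ≠ 0 := fun h => by
      rw [← sub_eq_zero.1 h, norm_one] at ht
      exact lt_irrefl _ ht
    simp only [hr, Function.comp, Complex.cpow_def_of_ne_zero h0]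
    rw [mul_comm (Complex.log _) s]
    ring
  have h2 : (fun t : ℂ => s ^ 2 * t ^ 2 - (1 + s * t) * r t) =O[𝓝 0] fun t => t ^ 2 := by
    refine ((Asymptotics.isBigO_refl _ _).const_mul_left _).sub ?_
    have h3 : (fun t : ℂ => 1 + s * t) =O[𝓝 0] fun _ => (1 : ℂ) :=
      ((by fun_prop : Continuous fun t : ℂ => 1 + s * t).tendsto 0).isBigO_one ℂ
    simpa using h3.mul hr2
  refine h2.congr_left fun t => ?_
  simp only [hr]
  ring

lemma gam_succ_mul_cpow_sub {s : ℂ} (hs : -2 < s.re) {n : ℕ} (hn : 1 ≤ n) :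
    gam s (n + 1) * ((n + 1 : ℕ) : ℂ) ^ s - gam s n * (n : ℂ) ^ s =
      gam s (n + 1) * ((n + 1 : ℕ) : ℂ) ^ s * (1 - (1 + s * (1 / ((n : ℂ) + 1))) *
        (1 - 1 / ((n : ℂ) + 1)) ^ s) := by
  have h1 : ((n + 1 : ℕ) : ℂ) ^ s * (1 - 1 / ((n : ℂ) + 1)) ^ s = (n : ℂ) ^ s := by
    have e : (1 - 1 / ((n : ℂ) + 1)) = ((1 - 1 / ((n : ℝ) + 1) : ℝ) : ℂ) := by push_cast; rfl
    have e2 : ((n + 1 : ℕ) : ℂ) = (((n + 1 : ℕ) : ℝ) : ℂ) := by push_cast; rfl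
    have h0 : 0 ≤ 1 - 1 / ((n : ℝ) + 1) := by
      rw [sub_nonneg, div_le_one (by positivity)]
      linarith [(Nat.cast_nonneg n : (0 : ℝ) ≤ n)]
    rw [e, e2, ← Complex.mul_cpow_ofReal_nonneg (by positivity) h0, ← Complex.ofReal_mul]
    congr 1
    have : (n : ℝ) + 1 ≠ 0 := by positivity
    push_cast
    field_simp
    simp
  rw [← gam_succ_mul hs hn, ← h1]
  ring

lemma isBigO_gam_mul_cpow_sub_one {s : ℂ} (hs : -2 < s.re) :
    (fun n : ℕ => gam s n * (n : ℂ) ^ s - 1) =O[atTop] fun n => ((n : ℝ))⁻¹ := by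
  set x : ℕ → ℂ := fun n => gam s n * (n : ℂ) ^ s with hx
  have hxl : Tendsto x atTop (𝓝 1) := tendsto_gam_mul_cpow hs
  have ht : Tendsto (fun n : ℕ => 1 / ((n : ℂ) + 1)) atTop (𝓝 0) :=
    tendsto_one_div_add_atTop_nhds_zero_nat
  obtain ⟨C, hC0, hC⟩ := ((isBigO_one_sub_mul_cpow s).comp_tendsto ht).exists_pos
  have hdiff : ∀ᶠ n in atTop, ‖x (n + 1) - x n‖ ≤ 2 * C * (1 / ((n : ℝ) + 1) ^ 2) := by
    filter_upwards [hC.bound, ((hxl.comp (tendsto_add_atTop_nat 1)).norm.eventually_le_const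
      (show ‖(1 : ℂ)‖ < 2 by norm_num)), eventually_ge_atTop 1] with n h1 h2 hn
    simp only [hx]
    rw [gam_succ_mul_cpow_sub hs hn, norm_mul]
    simp only [Function.comp] at h1 h2
    have e : ‖(1 / ((n : ℂ) + 1)) ^ 2‖ = 1 / ((n : ℝ) + 1) ^ 2 := by
      rw [norm_pow, norm_div, norm_one, div_pow, one_pow]
      norm_cast
    rw [e] at h1
    calc _ ≤ 2 * (C * (1 / ((n : ℝ) + 1) ^ 2)) := by
          refine mul_le_mul ?_ h1 (norm_nonneg _) (by norm_num)
          exact h2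
      _ = _ := by ring
  obtain ⟨J, hJ⟩ := eventually_atTop.1 hdiff
  refine Asymptotics.IsBigO.of_bound (2 * C) ?_
  filter_upwards [eventually_ge_atTop (max J 1)] with n hn
  have hn1 : 1 ≤ n := (le_max_right _ _).trans hn
  have key : ∀ M ≥ n, ‖x n - x M‖ ≤ 2 * C * (((n : ℝ))⁻¹ - ((M : ℝ))⁻¹) := by
    intro M hM
    induction M, hM using Nat.le_induction with
    | base => simp
    | succ M hM ih =>
      have h1 := hJ M ((le_max_left _ _).trans (hn.trans hM))
      have hM0 : (0 : ℝ) < M := by exact_mod_cast hn1.trans hM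
      have h2 : 1 / ((M : ℝ) + 1) ^ 2 ≤ ((M : ℝ))⁻¹ - (((M + 1 : ℕ) : ℝ))⁻¹ := by
        push_cast
        rw [inv_sub_inv hM0.ne' (by positivity)]
        rw [div_le_div_iff₀ (by positivity) (by positivity)]
        nlinarith
      rw [norm_sub_rev] at h1
      have h3 := norm_sub_le_norm_sub_add_norm_sub (x n) (x M) (x (M + 1))
      have h4 := mul_le_mul_of_nonneg_left h2 (show 0 ≤ 2 * C by positivity)
      linarith
  have hlim := (hxl.const_sub (x n)).norm
  rw [Real.norm_of_nonneg (by positivity), norm_sub_rev, norm_sub_rev]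
  refine le_of_tendsto hlim ?_
  filter_upwards [eventually_ge_atTop n] with M hM
  refine (key M hM).trans (mul_le_mul_of_nonneg_left ?_ (by positivity))
  have : 0 ≤ ((M : ℝ))⁻¹ := by positivity
  linarith

lemma tendsto_inv_sqrt_mul_inv_gam_sub_cpow {s : ℂ} (hs : -2 < s.re) (h : s.re < 3 / 2) :
    Tendsto (fun n : ℕ => ((√n : ℝ) : ℂ)⁻¹ * ((gam s n)⁻¹ - (n : ℂ) ^ s)) atTop (𝓝 0) := by
  have h1 := (isBigO_gam_mul_cpow_sub_one hs).norm_left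
  have h2 : (fun n : ℕ => ‖gam s n‖⁻¹) =O[atTop] fun n => (n : ℝ) ^ s.re := by
    refine Asymptotics.IsBigO.of_bound 2 ?_
    filter_upwards [(tendsto_norm_gam_mul_rpow hs).eventually_const_le
      (show (1 / 2 : ℝ) < 1 by norm_num), eventually_ge_atTop 1] with n h1 hn
    have := norm_pos_iff.2 (gam_ne_zero hs hn)
    rw [Real.norm_of_nonneg (by positivity), Real.norm_of_nonneg (by positivity),
      inv_le_iff_one_le_mul₀ this]
    linarith
  have h3 : Tendsto (fun n : ℕ => (√n)⁻¹ * ((n : ℝ) ^ s.re * ((n : ℝ))⁻¹)) atTop (𝓝 0) := by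
    refine ((tendsto_rpow_neg_atTop (show 0 < 3 / 2 - s.re by linarith)).comp
      (tendsto_natCast_atTop_atTop (R := ℝ))).congr' ?_
    filter_upwards [eventually_ge_atTop 1] with n hn
    have hn0 : (0 : ℝ) < n := by exact_mod_cast hn
    simp only [Function.comp]
    rw [Real.sqrt_eq_rpow, ← Real.rpow_neg hn0.le, ← Real.rpow_neg_one, ← Real.rpow_add hn0,
      ← Real.rpow_add hn0]
    congr 1
    ring
  have h4 := ((Asymptotics.isBigO_refl (fun n : ℕ => (√n)⁻¹) atTop).mul (h2.mul h1)).trans_tendsto h3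
  rw [tendsto_zero_iff_norm_tendsto_zero]
  refine h4.congr' ?_
  filter_upwards [eventually_ge_atTop 1] with n hn
  have h0 := gam_ne_zero hs hn
  rw [norm_mul, norm_inv, Complex.norm_real, Real.norm_of_nonneg (Real.sqrt_nonneg _), ← norm_inv,
    ← norm_mul, norm_sub_rev (gam s n)⁻¹]
  congr 2
  field_simp

lemma eventually_all_norm_mul_le {w : ℕ → ℕ → ℂ} {v : ℝ} (hw : IsNullArray w v) (c : ℂ) {ε : ℝ}
    (hε : 0 < ε) : ∀ᶠ n in atTop, ∀ j, ‖c * w n j‖ ≤ ε := by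
  filter_upwards [hw.eventually_norm_le (ε / (‖c‖ + 1)) (by positivity)] with n hn j
  rw [norm_mul]
  calc ‖c‖ * ‖w n j‖ ≤ (‖c‖ + 1) * (ε / (‖c‖ + 1)) := by
        gcongr
        · linarith
        · exact hn j
    _ = ε := by field_simp

lemma limVar_eq_of_im_eq_zero {m : ℕ} {a : ℕ → ℂ} (h : (a (m / 2)).im = 0) :
    limVar m a = (∑ k ∈ Finset.Icc 1 (m / 2), ‖a k‖ ^ 2 + ‖a (m / 2)‖ ^ 2) / 2 := by
  rw [limVar, Complex.sq_norm, Complex.normSq_apply, sq, Complex.mul_re, h]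
  simp

lemma totalWeight_sq_le (m : ℕ) (a : ℕ → ℂ) :
    totalWeight m a ^ 2 ≤ (m / 2 : ℕ) * ∑ k ∈ Finset.Icc 1 (m / 2), ‖a k‖ ^ 2 := by
  have := sq_sum_le_card_mul_sum_sq (s := Finset.Icc 1 (m / 2)) (f := fun k => ‖a k‖)
  rwa [Nat.card_Icc, Nat.add_sub_cancel] at this

namespace IsCyclicUrn

variable {Ω : Type*} [mΩ : MeasurableSpace Ω] {μ : Measure Ω} {m : ℕ} {j0 : Fin m}
  {R : ℕ → Ω → Fin m → ℝ}

lemma tendsto_integral_exp_of_isNullArray (hm : 2 ≤ m) (h2 : 2 ∣ m) (hR : IsCyclicUrn μ m j0 R)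
    {w : ℕ → ℕ → ℕ → ℂ} {v : ℕ → ℝ} {c : ℕ → ℂ} {Y : ℕ → Ω → ℝ}
    (hw : ∀ k ∈ Finset.Icc 1 (m / 2), IsNullArray (w k) (v k))
    (hre : ∀ n j, (c (m / 2) * w (m / 2) n j).im = 0)
    (hY : ∀ᶠ n in atTop, ∀ᵐ ω ∂μ,
      Tendsto (fun N => rowSum m R (fun j k => c k * w k n j) N ω) atTop (𝓝 (Y n ω))) :
    Tendsto (fun n => ∫ ω, cexp (Y n ω * I) ∂μ) atTop
      (𝓝 (Real.exp (-((∑ k ∈ Finset.Icc 1 (m / 2), ‖c k‖ ^ 2 * v k +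
        ‖c (m / 2)‖ ^ 2 * v (m / 2)) / 2) / 2) : ℂ)) := by
  have hmem : m / 2 ∈ Finset.Icc 1 (m / 2) := Finset.mem_Icc.2 ⟨by omega, le_rfl⟩
  have hLex : ∀ k, ∃ L : ℕ → ℝ, k ∈ Finset.Icc 1 (m / 2) →
      (∀ᶠ n in atTop, HasSum (fun j => ‖w k n j‖ ^ 2) (L n)) ∧ Tendsto L atTop (𝓝 (v k)) := by
    intro k
    by_cases hk : k ∈ Finset.Icc 1 (m / 2)
    · obtain ⟨L, hL⟩ := (hw k hk).exists_hasSum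
      exact ⟨L, fun _ => hL⟩
    · exact ⟨0, fun h => absurd h hk⟩
  choose L hL using hLex
  have hsum : ∀ᶠ n in atTop, ∀ k ∈ Finset.Icc 1 (m / 2),
      HasSum (fun j => ‖c k * w k n j‖ ^ 2) (‖c k‖ ^ 2 * L k n) := by
    rw [Filter.eventually_all_finset]
    intro k hk
    filter_upwards [(hL k hk).1] with n hn
    simpa only [norm_mul, mul_pow] using hn.mul_left (‖c k‖ ^ 2)
  have hbd : ∀ᶠ n in atTop, ∀ k ∈ Finset.Icc 1 (m / 2), L k n ≤ v k + 1 := by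
    rw [Filter.eventually_all_finset]
    intro k hk
    exact (hL k hk).2.eventually_le_const (lt_add_one _)
  refine hR.tendsto_integral_exp_of_rows hm h2 (a := fun n j k => c k * w k n j)
    (B := (m / 2 : ℕ) * ∑ k ∈ Finset.Icc 1 (m / 2), ‖c k‖ ^ 2 * (v k + 1))
    (L := fun n => (∑ k ∈ Finset.Icc 1 (m / 2), ‖c k‖ ^ 2 * L k n +
        ‖c (m / 2)‖ ^ 2 * L (m / 2) n) / 2) hY ?_ ?_ ?_ ?_
  · intro ε hε
    have h : ∀ᶠ n in atTop, ∀ k ∈ Finset.Icc 1 (m / 2), ∀ j,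
        ‖c k * w k n j‖ ≤ ε / (m / 2 : ℕ) := by
      rw [Filter.eventually_all_finset]
      intro k hk
      have : 0 < m / 2 := by omega
      exact eventually_all_norm_mul_le (hw k hk) _ (by positivity)
    filter_upwards [h] with n hn j
    refine (Finset.sum_le_card_nsmul _ _ _ fun k hk => hn k hk j).trans (le_of_eq ?_)
    have : ((m / 2 : ℕ) : ℝ) ≠ 0 := by
      have : m / 2 ≠ 0 := by omega
      exact_mod_cast this
    rw [Nat.card_Icc, Nat.add_sub_cancel, nsmul_eq_mul]
    field_simp
  · filter_upwards [hsum, hbd] with n hn hb N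
    refine (Finset.sum_le_sum fun j _ => totalWeight_sq_le m _).trans ?_
    rw [← Finset.mul_sum, Finset.sum_comm]
    gcongr with k hk
    refine ((hn k hk).summable.sum_le_tsum _ fun _ _ => by positivity).trans ?_
    rw [(hn k hk).tsum_eq]
    gcongr
    exact hb k hk
  · filter_upwards [hsum] with n hn
    refine HasSum.tendsto_sum_nat ?_
    have h : ∀ j, limVar m (fun k => c k * w k n j) = (∑ k ∈ Finset.Icc 1 (m / 2),
        ‖c k * w k n j‖ ^ 2 + ‖c (m / 2) * w (m / 2) n j‖ ^ 2) / 2 :=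
      fun j => limVar_eq_of_im_eq_zero (hre n j)
    simp only [h]
    exact ((hasSum_sum hn).add (hn _ hmem)).div_const 2
  · refine Tendsto.div_const (Tendsto.add (tendsto_finsetSum _ fun k hk => ?_) ?_) 2
    · exact (hL k hk).2.const_mul _
    · exact (hL _ hmem).2.const_mul _

end IsCyclicUrn

/-- The increments of the (unnormalized) martingale of the `k`-th Fourier coefficient. -/
def urnIncr {Ω : Type*} (m k : ℕ) (R : ℕ → Ω → Fin m → ℝ) (j : ℕ) (ω : Ω) : ℂ :=
  ucoef m k (R (j + 1) ω) - (1 + cw m ^ k / (j + 1)) * ucoef m k (R j ω)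

/-- The centered `k`-th Fourier coefficient of the urn. -/
def urnDev {Ω : Type*} [MeasurableSpace Ω] (μ : Measure Ω) (m k : ℕ) (R : ℕ → Ω → Fin m → ℝ)
    (n : ℕ) (ω : Ω) : ℂ :=
  ucoef m k fun t => R n ω t - expVec μ (R n) t

lemma rowSum_mul_eq {Ω : Type*} (m : ℕ) (R : ℕ → Ω → Fin m → ℝ) (c : ℕ → ℂ) (w : ℕ → ℕ → ℂ)
    (N : ℕ) (ω : Ω) :
    rowSum m R (fun j k => c k * w k j) N ω =
      (∑ k ∈ Finset.Icc 1 (m / 2), c k * ∑ j ∈ Finset.range N, w k j * urnIncr m k R j ω).re := by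
  simp only [rowSum, rowIncr, urnIncr, Finset.mul_sum]
  rw [Finset.sum_comm, Complex.re_sum]
  simp only [mul_assoc]

lemma neg_two_lt_cw_pow_re (m k : ℕ) : -2 < (cw m ^ k).re := by
  rw [cw_pow_re, lam]
  linarith [Real.neg_one_le_cos (2 * Real.pi * k / m)]

namespace IsCyclicUrn

variable {Ω : Type*} [mΩ : MeasurableSpace Ω] {μ : Measure Ω} {m : ℕ} {j0 : Fin m}
  {R : ℕ → Ω → Fin m → ℝ}

lemma integrable_coord (hR : IsCyclicUrn μ m j0 R) (n : ℕ) (i : Fin m) :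
    Integrable (fun ω => R n ω i) μ :=
  hR.integrable_coord_of_ae_sum (hR.ae_sum_eq n) i

lemma ucoef_expVec (hR : IsCyclicUrn μ m j0 R) (n k : ℕ) :
    ucoef m k (expVec μ (R n)) = ∫ ω, ucoef m k (R n ω) ∂μ := by
  simp only [ucoef, expVec]
  rw [integral_finsetSum _ fun i _ => ((hR.integrable_coord n i).ofReal).const_mul _]
  refine Finset.sum_congr rfl fun i _ => ?_
  rw [integral_const_mul, integral_complex_ofReal]

lemma urnDev_eq (hR : IsCyclicUrn μ m j0 R) (n k : ℕ) (ω : Ω) :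
    urnDev μ m k R n ω = ucoef m k (R n ω) - ∫ ω, ucoef m k (R n ω) ∂μ := by
  rw [urnDev, ucoef_sub, ← hR.ucoef_expVec]

lemma urnDev_zero (hR : IsCyclicUrn μ m j0 R) (k : ℕ) (ω : Ω) : urnDev μ m k R 0 ω = 0 := by
  have := hR.isProb
  rw [hR.urnDev_eq]
  simp [hR.init]

lemma urnIncr_eq (hR : IsCyclicUrn μ m j0 R) (k j : ℕ) (ω : Ω) :
    urnIncr m k R j ω =
      urnDev μ m k R (j + 1) ω - (1 + cw m ^ k / (j + 1)) * urnDev μ m k R j ω := by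
  rw [urnIncr, hR.urnDev_eq, hR.urnDev_eq, hR.integral_ucoef_succ]
  ring

lemma mart_eq_sum (hR : IsCyclicUrn μ m j0 R) (k n : ℕ) (ω : Ω) :
    Mart μ m k R n ω = ∑ j ∈ Finset.range n, gam (cw m ^ k) (j + 1) * urnIncr m k R j ω := by
  induction n with
  | zero => simp [Mart]
  | succ n ih =>
    rw [Finset.sum_range_succ, ← ih, hR.urnIncr_eq]
    have e : Mart μ m k R (n + 1) ω = gam (cw m ^ k) (n + 1) * urnDev μ m k R (n + 1) ω := by
      rw [Mart, if_neg n.succ_ne_zero]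
      rfl
    rw [e]
    rcases Nat.eq_zero_or_pos n with rfl | hn
    · simp [Mart, hR.urnDev_zero]
    · have e' : Mart μ m k R n ω = gam (cw m ^ k) n * urnDev μ m k R n ω := by
        rw [Mart, if_neg hn.ne']
        rfl
      rw [e', ← gam_succ_mul (neg_two_lt_cw_pow_re m k) hn]
      ring

lemma inv_gam_mul_mart (k : ℕ) {n : ℕ} (hn : 1 ≤ n) (ω : Ω) :
    (gam (cw m ^ k) n)⁻¹ * Mart μ m k R n ω = urnDev μ m k R n ω := by
  have : Mart μ m k R n ω = gam (cw m ^ k) n * urnDev μ m k R n ω := by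
    rw [Mart, if_neg (by omega)]
    rfl
  rw [this, inv_mul_cancel_left₀ (gam_ne_zero (neg_two_lt_cw_pow_re m k) hn)]

lemma tendsto_sum_headWeight (hR : IsCyclicUrn μ m j0 R) (k : ℕ) (σ : ℕ → ℝ) {n : ℕ} (hn : 1 ≤ n)
    (ω : Ω) :
    Tendsto (fun N => ∑ j ∈ Finset.range N, headWeight (cw m ^ k) σ n j * urnIncr m k R j ω) atTop
      (𝓝 ((σ n : ℂ)⁻¹ * urnDev μ m k R n ω)) := by
  refine tendsto_atTop_of_eventually_const (i₀ := n) fun N hN => ?_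
  rw [← inv_gam_mul_mart k hn, hR.mart_eq_sum, Finset.mul_sum, Finset.mul_sum,
    ← Finset.sum_subset (Finset.range_mono hN)]
  · refine Finset.sum_congr rfl fun j hj => ?_
    rw [headWeight, if_pos (Finset.mem_range.1 hj)]
    ring
  · intro j _ hj
    rw [headWeight, if_neg (by simpa using hj), zero_mul]

lemma tendsto_sum_tailWeight (hR : IsCyclicUrn μ m j0 R) (k : ℕ) (σ : ℕ → ℝ) {n : ℕ} (hn : 1 ≤ n)
    {ω : Ω} {ξ : ℂ} (h : Tendsto (fun n => Mart μ m k R n ω) atTop (𝓝 ξ)) :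
    Tendsto (fun N => ∑ j ∈ Finset.range N, tailWeight (cw m ^ k) σ n j * urnIncr m k R j ω) atTop
      (𝓝 ((σ n : ℂ)⁻¹ * (urnDev μ m k R n ω - (gam (cw m ^ k) n)⁻¹ * ξ))) := by
  have h1 : (σ n : ℂ)⁻¹ * (urnDev μ m k R n ω - (gam (cw m ^ k) n)⁻¹ * ξ) =
      -((σ n : ℂ)⁻¹ * (gam (cw m ^ k) n)⁻¹) * (ξ - Mart μ m k R n ω) := by
    rw [← inv_gam_mul_mart k hn]
    ring
  rw [h1]
  refine ((h.sub_const _).const_mul _).congr' ?_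
  filter_upwards [eventually_ge_atTop n] with N hN
  have h0 : ∑ j ∈ Finset.range n, tailWeight (cw m ^ k) σ n j * urnIncr m k R j ω = 0 := by
    refine Finset.sum_eq_zero fun j hj => ?_
    rw [tailWeight, if_neg (by simpa using hj), zero_mul]
  rw [hR.mart_eq_sum, hR.mart_eq_sum, ← Finset.sum_range_add_sum_Ico _ hN, add_sub_cancel_left,
    ← Finset.sum_range_add_sum_Ico _ hN, h0, zero_add, Finset.mul_sum]
  refine Finset.sum_congr rfl fun j hj => ?_
  rw [tailWeight, if_pos (Finset.mem_Ico.1 hj).1]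
  ring

end IsCyclicUrn

lemma lam_div_six {m : ℕ} (hm : 0 < m) (h6 : 6 ∣ m) : lam m (m / 6) = 1 / 2 := by
  obtain ⟨t, rfl⟩ := h6
  have ht : (t : ℝ) ≠ 0 := by
    have : t ≠ 0 := by omega
    exact_mod_cast this
  rw [lam, Nat.mul_div_cancel_left _ (by norm_num), ← Real.cos_pi_div_three]
  congr 1
  push_cast
  field_simp
  norm_num

lemma lam_strictAntiOn {m : ℕ} (hm : 0 < m) : StrictAntiOn (lam m) (Set.Iic (m / 2)) := by
  have hm' : (0 : ℝ) < m := by exact_mod_cast hm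
  have hmem : ∀ k ∈ Set.Iic (m / 2), 2 * Real.pi * k / m ∈ Set.Icc 0 Real.pi := by
    intro k hk
    have : (k : ℝ) * 2 ≤ m := by
      have : k * 2 ≤ m := by
        have := Set.mem_Iic.1 hk
        omega
      exact_mod_cast this
    refine ⟨by positivity, ?_⟩
    rw [div_le_iff₀ hm']
    nlinarith [Real.pi_pos]
  intro a ha b hb hab
  refine Real.strictAntiOn_cos (hmem a ha) (hmem b hb) ?_
  have := Real.pi_pos
  gcongr

lemma cw_pow_half {m : ℕ} (hm : 0 < m) (h2 : 2 ∣ m) : cw m ^ (m / 2) = -1 := by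
  obtain ⟨t, rfl⟩ := h2
  have ht : (t : ℝ) ≠ 0 := by
    have : t ≠ 0 := by omega
    exact_mod_cast this
  rw [cw_pow_eq, Nat.mul_div_cancel_left _ (by norm_num), ← Complex.exp_pi_mul_I]
  congr 3
  push_cast
  field_simp

lemma lam_half {m : ℕ} (hm : 0 < m) (h2 : 2 ∣ m) : lam m (m / 2) = -1 := by
  rw [← cw_pow_re, cw_pow_half hm h2]
  simp

/-- The weights of the martingale increments in the normalized `k`-th Fourier coefficient. -/
def normWeight (m k : ℕ) : ℕ → ℕ → ℂ :=
  if k < m / 6 then tailWeight (cw m ^ k) fun n => √n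
  else if k = m / 6 then headWeight (cw m ^ k) fun n => √(n * Real.log n)
  else headWeight (cw m ^ k) fun n => √n

/-- The limiting variance of the normalized `k`-th Fourier coefficient. -/
def normVar (m k : ℕ) : ℝ := if k = m / 6 then 1 else |2 * lam m k - 1|⁻¹

lemma normVar_half {m : ℕ} (hm : 0 < m) (h2 : 2 ∣ m) : normVar m (m / 2) = 1 / 3 := by
  rw [normVar, if_neg (by omega), lam_half hm h2]
  norm_num

lemma isNullArray_normWeight {m k : ℕ} (hm : 0 < m) (h6 : 6 ∣ m)
    (hk : k ∈ Finset.Icc 1 (m / 2)) : IsNullArray (normWeight m k) (normVar m k) := by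
  have hk' : k ∈ Set.Iic (m / 2) := (Finset.mem_Icc.1 hk).2
  have h6' : m / 6 ∈ Set.Iic (m / 2) := Set.mem_Iic.2 (by omega)
  have hre := cw_pow_re m k
  unfold normWeight normVar
  rcases lt_trichotomy k (m / 6) with h | h | h
  · have hl := lam_strictAntiOn hm hk' h6' h
    rw [lam_div_six hm h6] at hl
    rw [if_pos h, if_neg h.ne, abs_of_pos (by linarith), ← hre]
    exact isNullArray_tailWeight (norm_cw_pow m k) (by rw [hre]; exact hl)
  · rw [if_neg h.not_lt, if_pos h, if_pos h]
    exact isNullArray_headWeight_critical (norm_cw_pow m k) (by rw [hre, h, lam_div_six hm h6])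
  · have hl := lam_strictAntiOn hm h6' hk' h
    rw [lam_div_six hm h6] at hl
    rw [if_neg h.not_gt, if_neg h.ne', if_neg h.ne', abs_of_neg (by linarith), neg_sub, ← hre]
    exact isNullArray_headWeight (neg_two_lt_cw_pow_re m k) (norm_cw_pow m k) (by rw [hre]; exact hl)

lemma im_gam_neg_one (n : ℕ) : (gam (-1) n).im = 0 := by
  have : gam (-1) n = ((Real.Gamma (n + 1) / Real.Gamma (n + 1 + -1) : ℝ) : ℂ) := by
    rw [gam, Complex.ofReal_div, ← Complex.Gamma_ofReal, ← Complex.Gamma_ofReal]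
    push_cast
    rfl
  rw [this, Complex.ofReal_im]

lemma im_normWeight_half {m : ℕ} (hm : 0 < m) (h2 : 2 ∣ m) (n j : ℕ) :
    (normWeight m (m / 2) n j).im = 0 := by
  rw [normWeight, if_neg (by omega), if_neg (by omega), cw_pow_half hm h2, headWeight]
  split_ifs
  · have h1 : gam (-1) n = ((gam (-1) n).re : ℂ) := by
      rw [← Complex.re_add_im (gam (-1) n), im_gam_neg_one]
      simp
    have h2 : gam (-1) (j + 1) = ((gam (-1) (j + 1)).re : ℂ) := by
      rw [← Complex.re_add_im (gam (-1) (j + 1)), im_gam_neg_one]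
      simp
    rw [h1, h2]
    norm_cast
  · simp

/-- The normalized `k`-th Fourier coefficient, where the almost sure limit enters with the
factor `τ k n`. -/
def normCoef {Ω : Type*} [MeasurableSpace Ω] (μ : Measure Ω) (m : ℕ) (R : ℕ → Ω → Fin m → ℝ)
    (τ : ℕ → ℕ → ℂ) (Ξ : ℕ → Ω → ℂ) (n k : ℕ) (ω : Ω) : ℂ :=
  if k < m / 6 then ((√n : ℝ) : ℂ)⁻¹ * (urnDev μ m k R n ω - τ k n * Ξ k ω)
  else if k = m / 6 then ((√(n * Real.log n) : ℝ) : ℂ)⁻¹ * urnDev μ m k R n ω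
  else ((√n : ℝ) : ℂ)⁻¹ * urnDev μ m k R n ω

lemma tendsto_normCoef_sub {Ω : Type*} [MeasurableSpace Ω] {μ : Measure Ω} {m : ℕ}
    {R : ℕ → Ω → Fin m → ℝ} {Ξ : ℕ → Ω → ℂ} (k : ℕ) (ω : Ω) :
    Tendsto (fun n => normCoef μ m R (fun k n => (n : ℂ) ^ (cw m ^ k)) Ξ n k ω -
      normCoef μ m R (fun k n => (gam (cw m ^ k) n)⁻¹) Ξ n k ω) atTop (𝓝 0) := by
  unfold normCoef
  split_ifs
  · have h : (cw m ^ k).re < 3 / 2 := by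
      have := Complex.re_le_norm (cw m ^ k)
      rw [norm_cw_pow] at this
      linarith
    have := (tendsto_inv_sqrt_mul_inv_gam_sub_cpow (neg_two_lt_cw_pow_re m k) h).mul_const (Ξ k ω)
    rw [zero_mul] at this
    refine this.congr fun n => ?_
    ring
  all_goals simp only [sub_self, tendsto_const_nhds]

namespace IsCyclicUrn

variable {Ω : Type*} [mΩ : MeasurableSpace Ω] {μ : Measure Ω} {m : ℕ} {j0 : Fin m}
  {R : ℕ → Ω → Fin m → ℝ} {Ξ : ℕ → Ω → ℂ}

lemma measurable_urnDev (hR : IsCyclicUrn μ m j0 R) (k n : ℕ) :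
    Measurable (urnDev μ m k R n) := by
  refine (continuous_ucoef m k).measurable.comp (measurable_pi_lambda _ fun i => ?_)
  exact ((measurable_pi_apply i).comp (hR.meas n)).sub_const _

lemma measurable_mart (hR : IsCyclicUrn μ m j0 R) (k n : ℕ) : Measurable (Mart μ m k R n) := by
  rcases Nat.eq_zero_or_pos n with rfl | hn
  · exact measurable_const
  · unfold Mart
    simp only [if_neg hn.ne']
    exact (hR.measurable_urnDev k n).const_mul _

variable (hR : IsCyclicUrn μ m j0 R)
  (hΞ : ∀ k, 1 ≤ k → k ≤ m / 6 - 1 →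
    ∀ᵐ ω ∂μ, Tendsto (fun n => Mart μ m k R n ω) atTop (𝓝 (Ξ k ω)))

include hR hΞ

lemma aemeasurable_normCoef (τ : ℕ → ℕ → ℂ) (n : ℕ) {k : ℕ} (hk : 1 ≤ k) :
    AEMeasurable (normCoef μ m R τ Ξ n k) μ := by
  have h := hR.measurable_urnDev k n
  unfold normCoef
  split_ifs with h1 h2
  · have := aemeasurable_of_tendsto_metrizable_ae atTop
      (fun n => (hR.measurable_mart k n).aemeasurable) (hΞ k hk (by omega))
    exact (h.aemeasurable.sub (this.const_mul _)).const_mul _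
  · exact (h.const_mul _).aemeasurable
  · exact (h.const_mul _).aemeasurable

lemma ae_tendsto_sum_normWeight {n k : ℕ} (hn : 1 ≤ n) (hk : 1 ≤ k) :
    ∀ᵐ ω ∂μ, Tendsto (fun N => ∑ j ∈ Finset.range N, normWeight m k n j * urnIncr m k R j ω) atTop
      (𝓝 (normCoef μ m R (fun k n => (gam (cw m ^ k) n)⁻¹) Ξ n k ω)) := by
  unfold normWeight normCoef
  split_ifs with h1 h2
  · filter_upwards [hΞ k hk (by omega)] with ω hω
    exact hR.tendsto_sum_tailWeight k (fun n => √n) hn hω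
  · exact Eventually.of_forall fun ω =>
      hR.tendsto_sum_headWeight k (fun n => √(n * Real.log n)) hn ω
  · exact Eventually.of_forall fun ω => hR.tendsto_sum_headWeight k (fun n => √n) hn ω

lemma tendsto_integral_exp_normCoef_gam (hm : 0 < m) (h6 : 6 ∣ m) {c : ℕ → ℂ}
    (hc : (c (m / 2)).im = 0) :
    Tendsto (fun n => ∫ ω, cexp ((∑ k ∈ Finset.Icc 1 (m / 2),
        c k * normCoef μ m R (fun k n => (gam (cw m ^ k) n)⁻¹) Ξ n k ω).re * I) ∂μ) atTop
      (𝓝 (Real.exp (-((∑ k ∈ Finset.Icc 1 (m / 2), ‖c k‖ ^ 2 * normVar m k +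
        ‖c (m / 2)‖ ^ 2 * normVar m (m / 2)) / 2) / 2) : ℂ)) := by
  have h2 : 2 ∣ m := (by norm_num : 2 ∣ 6).trans h6
  refine hR.tendsto_integral_exp_of_isNullArray (by omega) h2
    (fun k hk => isNullArray_normWeight hm h6 hk) (fun n j => ?_) ?_
  · rw [Complex.mul_im, hc, im_normWeight_half hm h2]
    simp
  · filter_upwards [eventually_ge_atTop 1] with n hn
    have h : ∀ᵐ ω ∂μ, ∀ k ∈ Finset.Icc 1 (m / 2), Tendsto (fun N => ∑ j ∈ Finset.range N,
        normWeight m k n j * urnIncr m k R j ω) atTop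
        (𝓝 (normCoef μ m R (fun k n => (gam (cw m ^ k) n)⁻¹) Ξ n k ω)) := by
      rw [Filter.eventually_all_finset]
      exact fun k hk => hR.ae_tendsto_sum_normWeight hΞ hn (Finset.mem_Icc.1 hk).1
    filter_upwards [h] with ω hω
    simp only [rowSum_mul_eq m R c (fun k j => normWeight m k n j)]
    exact (Complex.continuous_re.tendsto _).comp
      (tendsto_finsetSum _ fun k hk => (hω k hk).const_mul _)

lemma tendsto_integral_exp_normCoef (hm : 0 < m) (h6 : 6 ∣ m) {c : ℕ → ℂ}
    (hc : (c (m / 2)).im = 0) :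
    Tendsto (fun n => ∫ ω, cexp ((∑ k ∈ Finset.Icc 1 (m / 2),
        c k * normCoef μ m R (fun k n => (n : ℂ) ^ (cw m ^ k)) Ξ n k ω).re * I) ∂μ) atTop
      (𝓝 (Real.exp (-((∑ k ∈ Finset.Icc 1 (m / 2), ‖c k‖ ^ 2 * normVar m k +
        ‖c (m / 2)‖ ^ 2 * normVar m (m / 2)) / 2) / 2) : ℂ)) := by
  have := hR.isProb
  have hmeas : ∀ (τ : ℕ → ℕ → ℂ) (n : ℕ), AEStronglyMeasurable (fun ω =>
      cexp ((∑ k ∈ Finset.Icc 1 (m / 2), c k * normCoef μ m R τ Ξ n k ω).re * I)) μ := by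
    intro τ n
    have h : AEMeasurable (fun ω => ∑ k ∈ Finset.Icc 1 (m / 2), c k * normCoef μ m R τ Ξ n k ω) μ :=
      Finset.aemeasurable_fun_sum _ fun k hk =>
        (hR.aemeasurable_normCoef hΞ τ n (Finset.mem_Icc.1 hk).1).const_mul _
    exact ((by fun_prop : Continuous fun z : ℂ => cexp (z.re * I)).measurable.comp_aemeasurable
      h).aestronglyMeasurable
  have hInt : ∀ (τ : ℕ → ℕ → ℂ) (n : ℕ), Integrable (fun ω =>
      cexp ((∑ k ∈ Finset.Icc 1 (m / 2), c k * normCoef μ m R τ Ξ n k ω).re * I)) μ := fun τ n =>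
    Integrable.of_bound (hmeas τ n) 1 (Eventually.of_forall fun ω =>
      (Complex.norm_exp_ofReal_mul_I _).le)
  have hd : ∀ ω, Tendsto (fun n => ∑ k ∈ Finset.Icc 1 (m / 2),
      c k * normCoef μ m R (fun k n => (n : ℂ) ^ (cw m ^ k)) Ξ n k ω -
      ∑ k ∈ Finset.Icc 1 (m / 2),
      c k * normCoef μ m R (fun k n => (gam (cw m ^ k) n)⁻¹) Ξ n k ω) atTop (𝓝 0) := by
    intro ω
    simp only [← Finset.sum_sub_distrib, ← mul_sub]
    rw [← Finset.sum_const_zero (s := Finset.Icc 1 (m / 2))]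
    refine tendsto_finsetSum _ fun k _ => ?_
    rw [← mul_zero (c k)]
    exact (tendsto_normCoef_sub k ω).const_mul _
  have hexp : ∀ x y : ℝ, cexp (x * I) - cexp (y * I) =
      cexp (y * I) * (cexp ((x - y : ℝ) * I) - 1) := by
    intro x y
    rw [mul_sub, ← Complex.exp_add, mul_one]
    congr 2
    push_cast
    ring
  have hlim := tendsto_integral_of_dominated_convergence (fun _ => (2 : ℝ))
    (fun n => (hmeas (fun k n => (n : ℂ) ^ (cw m ^ k)) n).sub
      (hmeas (fun k n => (gam (cw m ^ k) n)⁻¹) n)) (integrable_const _)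
    (fun n => Eventually.of_forall fun ω => ?_) (Eventually.of_forall fun ω => ?_)
    (f := fun _ => (0 : ℂ))
  · rw [integral_zero] at hlim
    refine (zero_add (_ : ℂ) ▸ hlim.add (hR.tendsto_integral_exp_normCoef_gam hΞ hm h6 hc)).congr
      fun n => ?_
    simp only [Pi.sub_apply]
    rw [integral_sub (hInt _ n) (hInt _ n), sub_add_cancel]
  · refine (norm_sub_le _ _).trans ?_
    rw [Complex.norm_exp_ofReal_mul_I, Complex.norm_exp_ofReal_mul_I]
    norm_num
  · simp only [Pi.sub_apply, hexp]
    rw [tendsto_zero_iff_norm_tendsto_zero]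
    simp only [norm_mul, Complex.norm_exp_ofReal_mul_I, one_mul, ← Complex.sub_re]
    have h := ((by fun_prop : Continuous fun z : ℂ => ‖cexp (z.re * I) - 1‖).tendsto 0).comp (hd ω)
    rwa [Complex.zero_re, Complex.ofReal_zero, zero_mul, Complex.exp_zero, sub_self, norm_zero] at h

end IsCyclicUrn

lemma sum_range_two_mul_eq {M : Type*} [AddCommMonoid M] (F : ℕ → M) (p : ℕ) :
    ∑ i ∈ Finset.range (2 * p), F i =
      ∑ k ∈ Finset.Icc 1 p, (F (2 * k - 2) + F (2 * k - 1)) := by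
  induction p with
  | zero => simp
  | succ p ih =>
    rw [Finset.sum_Icc_succ_top (by omega), ← ih, mul_add, mul_one, Finset.sum_range_succ,
      Finset.sum_range_succ, add_assoc]
    rfl

lemma sum_fin_pred_eq {M : Type*} [AddCommMonoid M] {m : ℕ} (hm : 0 < m) (h2 : 2 ∣ m) {F : ℕ → M}
    (hF : F (m - 1) = 0) :
    ∑ i : Fin (m - 1), F i = ∑ k ∈ Finset.Icc 1 (m / 2), (F (2 * k - 2) + F (2 * k - 1)) := by
  rw [← sum_range_two_mul_eq, Nat.mul_div_cancel' h2, Fin.sum_univ_eq_sum_range,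
    ← Nat.sub_add_cancel hm, Finset.sum_range_succ, Nat.add_sub_cancel, hF, add_zero]

/-- The coefficient vector `l`, extended by zero. -/
def extendZero {d : ℕ} (l : Fin d → ℝ) (j : ℕ) : ℝ := if h : j < d then l ⟨j, h⟩ else 0

lemma extendZero_coe {d : ℕ} (l : Fin d → ℝ) (i : Fin d) : extendZero l i = l i := by
  rw [extendZero, dif_pos i.2]

lemma extendZero_self {d : ℕ} (l : Fin d → ℝ) : extendZero l d = 0 := by
  rw [extendZero, dif_neg (lt_irrefl _)]

/-- The complex coefficient of the `k`-th Fourier coefficient in the linear functional `l`. -/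
def fourierWeight {d : ℕ} (l : Fin d → ℝ) (k : ℕ) : ℂ :=
  ⟨extendZero l (2 * k - 2), -extendZero l (2 * k - 1)⟩

lemma sum_mul_MmDiag {m : ℕ} (hm : 0 < m) (h6 : 6 ∣ m) (l : Fin (m - 1) → ℝ) :
    ∑ i, l i ^ 2 * MmDiag m i =
      (∑ k ∈ Finset.Icc 1 (m / 2), ‖fourierWeight l k‖ ^ 2 * normVar m k +
        ‖fourierWeight l (m / 2)‖ ^ 2 * normVar m (m / 2)) / 2 := by
  have h2 : 2 ∣ m := (by norm_num : 2 ∣ 6).trans h6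
  set D : ℕ → ℝ := fun i => if i = m - 2 then 1 / 3 else normVar m (i / 2 + 1) / 2 with hD
  have hDiag : ∀ i : Fin (m - 1), MmDiag m i = D i := by
    intro i
    simp only [MmDiag, hD, normVar]
    split_ifs <;> ring
  have hmem : m / 2 ∈ Finset.Icc 1 (m / 2) := Finset.mem_Icc.2 ⟨by omega, le_rfl⟩
  have hnorm : ∀ k, ‖fourierWeight l k‖ ^ 2 =
      extendZero l (2 * k - 2) ^ 2 + extendZero l (2 * k - 1) ^ 2 := by
    intro k
    rw [Complex.sq_norm, Complex.normSq_apply, fourierWeight]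
    ring
  calc ∑ i, l i ^ 2 * MmDiag m i
      = ∑ i : Fin (m - 1), extendZero l (i : ℕ) ^ 2 * D i := by
        simp only [extendZero_coe, hDiag]
    _ = ∑ k ∈ Finset.Icc 1 (m / 2), (extendZero l (2 * k - 2) ^ 2 * D (2 * k - 2) +
          extendZero l (2 * k - 1) ^ 2 * D (2 * k - 1)) :=
        sum_fin_pred_eq hm h2 (F := fun i => extendZero l i ^ 2 * D i)
          (by rw [extendZero_self]; ring)
    _ = ∑ k ∈ Finset.Icc 1 (m / 2), (‖fourierWeight l k‖ ^ 2 * normVar m k +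
          if k = m / 2 then ‖fourierWeight l k‖ ^ 2 * normVar m k else 0) / 2 := by
        refine Finset.sum_congr rfl fun k hk => ?_
        obtain ⟨hk1, hk2⟩ := Finset.mem_Icc.1 hk
        have e1 : (2 * k - 2) / 2 + 1 = k := by omega
        have e2 : (2 * k - 1) / 2 + 1 = k := by omega
        rw [hnorm]
        split_ifs with h
        · have e3 : 2 * k - 1 = m - 1 := by omega
          rw [h, normVar_half hm h2, ← h, e3, extendZero_self]
          simp only [hD]
          rw [if_pos (by omega)]
          ring
        · simp only [hD, e1, e2]
          rw [if_neg (by omega), if_neg (by omega)]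
          ring
    _ = _ := by
        rw [← Finset.sum_div, Finset.sum_add_distrib, Finset.sum_ite_eq' _ _ _, if_pos hmem]

lemma MmDiag_nonneg (m : ℕ) (i : Fin (m - 1)) : 0 ≤ MmDiag m i := by
  unfold MmDiag
  split_ifs <;> positivity

namespace IsCyclicUrn

variable {Ω : Type*} [mΩ : MeasurableSpace Ω] {μ : Measure Ω} {m : ℕ} {j0 : Fin m}
  {R : ℕ → Ω → Fin m → ℝ} {Ξ : ℕ → Ω → ℂ}

lemma integral_ucoef_half (hR : IsCyclicUrn μ m j0 R) (hm : 0 < m) (h2 : 2 ∣ m) {n : ℕ}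
    (hn : 1 ≤ n) : ∫ ω, ucoef m (m / 2) (R n ω) ∂μ = 0 := by
  induction n, hn using Nat.le_induction with
  | base =>
    rw [hR.integral_ucoef_succ 0, cw_pow_half hm h2]
    simp
  | succ n _ ih => rw [hR.integral_ucoef_succ, ih, mul_zero]

lemma zvec_eq (hR : IsCyclicUrn μ m j0 R) (hm : 0 < m) (h6 : 6 ∣ m) {n : ℕ} (hn : 1 ≤ n) (ω : Ω)
    (i : Fin (m - 1)) :
    Zvec μ m R Ξ n ω i =
      if (i : ℕ) % 2 = 0 then
        (normCoef μ m R (fun k n => (n : ℂ) ^ (cw m ^ k)) Ξ n ((i : ℕ) / 2 + 1) ω).re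
      else (normCoef μ m R (fun k n => (n : ℂ) ^ (cw m ^ k)) Ξ n ((i : ℕ) / 2 + 1) ω).im := by
  have h2 : 2 ∣ m := (by norm_num : 2 ∣ 6).trans h6
  by_cases h : (i : ℕ) = m - 2
  · have e : (i : ℕ) / 2 + 1 = m / 2 := by omega
    rw [Zvec, if_pos h, if_pos (by omega), e, normCoef, if_neg (by omega), if_neg (by omega),
      hR.urnDev_eq, hR.integral_ucoef_half hm h2 hn, sub_zero, ← Complex.ofReal_inv,
      Complex.re_ofReal_mul]
  · rw [Zvec, if_neg h]
    rfl

lemma sum_mul_zvec (hR : IsCyclicUrn μ m j0 R) (hm : 0 < m) (h6 : 6 ∣ m) {n : ℕ} (hn : 1 ≤ n)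
    (ω : Ω) (l : Fin (m - 1) → ℝ) :
    ∑ i, l i * Zvec μ m R Ξ n ω i = (∑ k ∈ Finset.Icc 1 (m / 2), fourierWeight l k *
      normCoef μ m R (fun k n => (n : ℂ) ^ (cw m ^ k)) Ξ n k ω).re := by
  set X : ℕ → ℂ := fun k => normCoef μ m R (fun k n => (n : ℂ) ^ (cw m ^ k)) Ξ n k ω with hX
  calc ∑ i, l i * Zvec μ m R Ξ n ω i
      = ∑ i : Fin (m - 1), extendZero l (i : ℕ) *
          if (i : ℕ) % 2 = 0 then (X ((i : ℕ) / 2 + 1)).re else (X ((i : ℕ) / 2 + 1)).im := by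
        simp only [extendZero_coe, hR.zvec_eq hm h6 hn, hX]
    _ = ∑ k ∈ Finset.Icc 1 (m / 2),
          (extendZero l (2 * k - 2) *
            (if (2 * k - 2) % 2 = 0 then (X ((2 * k - 2) / 2 + 1)).re
              else (X ((2 * k - 2) / 2 + 1)).im) +
          extendZero l (2 * k - 1) *
            if (2 * k - 1) % 2 = 0 then (X ((2 * k - 1) / 2 + 1)).re
              else (X ((2 * k - 1) / 2 + 1)).im) :=
        sum_fin_pred_eq hm ((by norm_num : 2 ∣ 6).trans h6)
          (F := fun i => extendZero l i *
            if i % 2 = 0 then (X (i / 2 + 1)).re else (X (i / 2 + 1)).im)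
          (by rw [extendZero_self, zero_mul])
    _ = _ := by
        rw [Complex.re_sum]
        refine Finset.sum_congr rfl fun k hk => ?_
        have hk1 := (Finset.mem_Icc.1 hk).1
        have e1 : (2 * k - 2) / 2 + 1 = k := by omega
        have e2 : (2 * k - 1) / 2 + 1 = k := by omega
        rw [if_pos (by omega), if_neg (by omega), e1, e2, Complex.mul_re, fourierWeight]
        ring

lemma aemeasurable_zvec (hR : IsCyclicUrn μ m j0 R)
    (hΞ : ∀ k, 1 ≤ k → k ≤ m / 6 - 1 →
      ∀ᵐ ω ∂μ, Tendsto (fun n => Mart μ m k R n ω) atTop (𝓝 (Ξ k ω))) (n : ℕ) :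
    AEMeasurable (fun ω => Zvec μ m R Ξ n ω) μ := by
  refine aemeasurable_pi_lambda _ fun i => ?_
  have h := hR.aemeasurable_normCoef hΞ (fun k n => (n : ℂ) ^ (cw m ^ k)) n
    (Nat.le_add_left 1 ((i : ℕ) / 2))
  by_cases h1 : (i : ℕ) = m - 2
  · simp only [Zvec, if_pos h1]
    exact ((Complex.measurable_re.comp ((continuous_ucoef m _).measurable.comp
      (hR.meas n))).const_mul _).aemeasurable
  · by_cases h2 : (i : ℕ) % 2 = 0
    · simp only [Zvec, if_neg h1, if_pos h2]
      exact Complex.measurable_re.comp_aemeasurable h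
    · simp only [Zvec, if_neg h1, if_neg h2]
      exact Complex.measurable_im.comp_aemeasurable h

end IsCyclicUrn

theorem stmt2 {Ω : Type*} [MeasurableSpace Ω] (μ : Measure Ω) (m : ℕ) (hpos : 0 < m)
    (h6 : 6 ∣ m) (R : ℕ → Ω → Fin m → ℝ)
    (hR : IsCyclicUrn μ m ⟨0, hpos⟩ R) (Ξ : ℕ → Ω → ℂ)
    (hΞ : ∀ k, 1 ≤ k → k ≤ m / 6 - 1 →
      ∀ᵐ ω ∂μ, Tendsto (fun n => Mart μ m k R n ω) atTop (𝓝 (Ξ k ω))) :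
    ∃ ν : Measure (Fin (m - 1) → ℝ),
      IsCenteredGaussian ν (MmMat m) ∧
      TendstoInDist μ (fun n ω => Zvec μ m R Ξ n ω) ν := by
  have := hR.isProb
  refine ⟨_, isCenteredGaussian_pi _ (MmDiag_nonneg m),
    tendstoInDist_of_tendsto_integral_exp (hR.aemeasurable_zvec hΞ) fun l => ?_⟩
  rw [integral_exp_sum_pi_gaussianReal _ (MmDiag_nonneg m), sum_mul_MmDiag hpos h6]
  have hc : (fourierWeight l (m / 2)).im = 0 := by
    have e : 2 * (m / 2) - 1 = m - 1 := by omega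
    rw [fourierWeight, e, extendZero_self, neg_zero]
  have h := hR.tendsto_integral_exp_normCoef hΞ hpos h6 hc
  rw [Complex.ofReal_exp, Complex.ofReal_div, Complex.ofReal_neg] at h
  refine h.congr' ?_
  filter_upwards [eventually_ge_atTop 1] with n hn
  simp only [hR.sum_mul_zvec hpos h6 hn]

end
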